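/- arXiv:1210.4354 — 6 statements merged into one kernel-verified Lean document; each statement's English description precedes it below -/
import Mathlib

section
/- Let d ≥ 2 and let f : ℝ^d → ℝ be continuous on the closed unit ball B̄^d. Fix a unit vector p and a unit vector v orthogonal to p, and write c(θ) = cos(θ)p + sin(θ)v. Suppose that for every integer n ≥ 1 and every integer m, setting α = 2πm/n, one has Σ_{l=1}^{n} ∫_{[c((l−1)α), c(lα)]} f dH¹ = 0 (these are the broken rays lying in the plane spanned by p and v that start and end at the point p). Then for every r ∈ [0,1], ∫₀^{2π} f(r cos θ · p + r sin θ · v) dθ = 0; that is, singleton tomography at p determines the integral of f over every circle centered at the origin lying in a plane through p and the origin. -/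
open Real MeasureTheory Set
open scoped RealInnerProductSpace

/-- Arclength integral of `f` over the segment `[a, b]`. -/
noncomputable def segInt {d : ℕ} (f : EuclideanSpace ℝ (Fin d) → ℝ)
    (a b : EuclideanSpace ℝ (Fin d)) : ℝ :=
  ‖b - a‖ * ∫ t in (0:ℝ)..1, f ((1 - t) • a + t • b)

/-- If all parabolic averages `∫₀¹ K (4t(1-t)a) dt` vanish for `0 < a ≤ 1`, then so does the
integral over the unit disk of the radial function `z ↦ K (c (1 - |z|²))`. -/
lemma integral_disk_eq_zero {K : ℝ → ℝ} (hK : Continuous K)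
    (h : ∀ a ∈ Ioc (0 : ℝ) 1, ∫ t in (0 : ℝ)..1, K (4 * t * (1 - t) * a) = 0)
    {c : ℝ} (hc : c ∈ Ioc (0 : ℝ) 1) :
    ∫ z : ℂ, (Iic (1 : ℝ)).indicator (fun y => K (c * (1 - y ^ 2))) ‖z‖ = 0 := by
  set φ : ℝ → ℝ := (Iic (1 : ℝ)).indicator (fun y => K (c * (1 - y ^ 2))) with hφ
  have hint : Integrable (fun z : ℂ => φ ‖z‖) := by
    have h1 : (fun z : ℂ => φ ‖z‖) =
        (Metric.closedBall (0 : ℂ) 1).indicator (fun z => K (c * (1 - ‖z‖ ^ 2))) := by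
      ext z
      simp [hφ, indicator]
    rw [h1, integrable_indicator_iff measurableSet_closedBall]
    exact ContinuousOn.integrableOn_compact (isCompact_closedBall _ _) (by fun_prop)
  have hmp := Complex.volume_preserving_equiv_real_prod.symm
  rw [← hmp.integral_comp', Measure.volume_eq_prod, integral_prod]
  swap
  · exact (hmp.integrable_comp_emb (MeasurableEquiv.measurableEmbedding _)).2 hint
  refine integral_eq_zero_of_ae (.of_forall fun x => ?_)
  have hn (y : ℝ) : ‖Complex.measurableEquivRealProd.symm (x, y)‖ = √(x ^ 2 + y ^ 2) := by
    rw [Complex.measurableEquivRealProd_symm_apply, Complex.norm_eq_sqrt_sq_add_sq]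
  have hs1 (u : ℝ) : √u ≤ 1 ↔ u ≤ 1 := by simp [Real.sqrt_le_iff]
  simp only [hn, Pi.zero_apply]
  rcases lt_or_ge 1 (x ^ 2) with hx | hx
  · refine integral_eq_zero_of_ae (.of_forall fun y => ?_)
    refine indicator_of_notMem ?_ _
    rw [mem_Iic, hs1]
    nlinarith [sq_nonneg y]
  set R := √(1 - x ^ 2) with hR
  have hR0 : 0 ≤ R := Real.sqrt_nonneg _
  have hR2 : R ^ 2 = 1 - x ^ 2 := Real.sq_sqrt (by linarith)
  have h2 : (fun y => φ √(x ^ 2 + y ^ 2)) =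
      (Icc (-R) R).indicator (fun y => K (c * (R ^ 2 - y ^ 2))) := by
    ext y
    have hy : √(x ^ 2 + y ^ 2) ≤ 1 ↔ -R ≤ y ∧ y ≤ R := by
      rw [hs1, ← abs_le, ← sq_le_sq₀ (abs_nonneg y) hR0, sq_abs, hR2]
      constructor <;> intro h <;> linarith
    have hs : √(x ^ 2 + y ^ 2) ^ 2 = x ^ 2 + y ^ 2 := Real.sq_sqrt (by positivity)
    simp only [hφ, indicator, mem_Iic, mem_Icc, hy, hs, hR2]
    congr 3
    ring
  rw [h2, integral_indicator measurableSet_Icc, integral_Icc_eq_integral_Ioc,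
    ← intervalIntegral.integral_of_le (by linarith)]
  have h3 := intervalIntegral.smul_integral_comp_mul_sub (a := 0) (b := 1)
    (fun y => K (c * (R ^ 2 - y ^ 2))) (2 * R) R
  have h4 : (2 * R) * 0 - R = -R := by ring
  have h5 : (2 * R) * 1 - R = R := by ring
  rw [h4, h5] at h3
  rw [← h3]
  rcases hR0.eq_or_lt with h0 | h0
  · simp [← h0]
  have h6 : c * R ^ 2 ∈ Ioc (0 : ℝ) 1 := by
    refine ⟨by have := hc.1; positivity, ?_⟩
    have : R ^ 2 ≤ 1 := by nlinarith [sq_nonneg x]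
    nlinarith [hc.1, hc.2]
  refine smul_eq_zero_of_right _ ?_
  convert h _ h6 using 3
  ring_nf

/-- Injectivity of the Abel transform on continuous functions. -/
lemma eq_zero_of_parabolic_averages {K : ℝ → ℝ} (hK : Continuous K)
    (h : ∀ a ∈ Ioc (0 : ℝ) 1, ∫ t in (0 : ℝ)..1, K (4 * t * (1 - t) * a) = 0) :
    ∀ x ∈ Icc (0 : ℝ) 1, K x = 0 := by
  have hprim : ∀ c ∈ Ioc (0 : ℝ) 1, ∫ x in (0 : ℝ)..c, K x = 0 := by
    intro c hc
    have h1 := integral_disk_eq_zero hK h hc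
    rw [integral_fun_norm_addHaar, Complex.finrank_real_complex] at h1
    have h2 : volume.real (Metric.ball (0 : ℂ) 1) ≠ 0 := by
      simp [Measure.real, Real.pi_ne_zero]
    have h3 : ∫ y in Ioi (0 : ℝ), y ^ (2 - 1) •
        (Iic (1 : ℝ)).indicator (fun y => K (c * (1 - y ^ 2))) y = 0 := by
      simpa [h2] using h1
    have h4 : (fun y : ℝ => y ^ (2 - 1) •
        (Iic (1 : ℝ)).indicator (fun y => K (c * (1 - y ^ 2))) y) =
        (Iic (1 : ℝ)).indicator (fun y => y * K (c * (1 - y ^ 2))) := by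
      ext y
      simp [indicator]
    rw [h4, setIntegral_indicator measurableSet_Iic, Ioi_inter_Iic,
      ← intervalIntegral.integral_of_le zero_le_one] at h3
    have h5 := intervalIntegral.integral_comp_mul_deriv (a := 0) (b := 1)
      (f := fun y => c * (1 - y ^ 2)) (f' := fun y => c * (-(2 * y))) (g := K)
      (fun y _ => by
        have := (((hasDerivAt_id y).pow 2).const_sub 1).const_mul c
        simpa using this) (by fun_prop) hK
    have h6 : ∫ y in (0 : ℝ)..1, (K ∘ fun y => c * (1 - y ^ 2)) y * (c * (-(2 * y))) =
        (-2 * c) * ∫ y in (0 : ℝ)..1, y * K (c * (1 - y ^ 2)) := by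
      rw [← intervalIntegral.integral_const_mul]
      congr 1
      ext y
      simp only [Function.comp]
      ring
    rw [h6, h3] at h5
    rw [intervalIntegral.integral_symm]
    simpa using h5.symm
  have hIoo : Ioo (0 : ℝ) 1 ⊆ {x | K x = 0} := by
    intro x hx
    have h1 := hK.deriv_integral K 0 x
    have h2 : (fun u => ∫ t in (0 : ℝ)..u, K t) =ᶠ[nhds x] fun _ => 0 := by
      filter_upwards [isOpen_Ioo.mem_nhds hx] with u hu
      exact hprim u ⟨hu.1, hu.2.le⟩
    rw [h2.deriv_eq, deriv_const] at h1
    exact h1.symm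
  have := closure_minimal hIoo (isClosed_eq hK continuous_const)
  rwa [closure_Ioo zero_ne_one] at this

/-- Multiplication by a nonzero residue permutes the `q`-division points of a period, `q` prime. -/
lemma sum_range_periodic_mul_div {g : ℝ → ℝ} (hg : Function.Periodic g 1) {q m : ℕ}
    (hq : q.Prime) (hm : 0 < m) (hmq : m < q) :
    ∑ l ∈ Finset.range q, g (l * (m / q)) = ∑ j ∈ Finset.range q, g (j / q) := by
  have : Fact q.Prime := ⟨hq⟩
  have hq0 : (q : ℝ) ≠ 0 := by exact_mod_cast hq.ne_zero
  set T : ZMod q → ℝ := fun a => g (a.val / q) with hT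
  have hcast (k : ℕ) : g (k / q) = T k := by
    have h1 : (k : ℝ) / q = ((k % q : ℕ) : ℝ) / q + ((k / q : ℕ) : ℝ) * 1 := by
      have h2 : ((k % q : ℕ) : ℝ) + q * ((k / q : ℕ) : ℝ) = k := by
        exact_mod_cast Nat.mod_add_div k q
      rw [← h2]
      field_simp
    rw [hT]
    simp only [ZMod.val_natCast]
    rw [h1]
    exact hg.nat_mul _ _
  have hsum (S : ZMod q → ℝ) : ∑ l ∈ Finset.range q, S l = ∑ a, S a := by
    refine Finset.sum_nbij' (fun l => (l : ZMod q)) ZMod.val (by simp) ?_ ?_ (by simp) (by simp)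
    · intro a _
      exact Finset.mem_range.2 (ZMod.val_lt a)
    · intro l hl
      exact ZMod.val_cast_of_lt (Finset.mem_range.1 hl)
  have hm0 : (m : ZMod q) ≠ 0 := by
    rw [Ne, ZMod.natCast_eq_zero_iff]
    exact Nat.not_dvd_of_pos_of_lt hm hmq
  calc ∑ l ∈ Finset.range q, g (l * (m / q))
      = ∑ l ∈ Finset.range q, T (l * m) := by
        refine Finset.sum_congr rfl fun l _ => ?_
        rw [← Nat.cast_mul, ← hcast, Nat.cast_mul, mul_div_assoc]
    _ = ∑ a : ZMod q, T (a * m) := hsum fun a => T (a * m)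
    _ = ∑ a : ZMod q, T a := Equiv.sum_comp (Equiv.mulRight₀ (m : ZMod q) hm0) T
    _ = ∑ j ∈ Finset.range q, g (j / q) := by
        rw [← hsum]
        exact Finset.sum_congr rfl fun j _ => (hcast j).symm

/-- If the sums of `G (·, m / n)` over the closed orbits of the rotation by `m / n` vanish, then
the mean of `G (·, σ)` over a period vanishes for every `σ`. -/
lemma integral_eq_zero_of_orbit_sums {G : ℝ → ℝ → ℝ} (hG : Continuous (Function.uncurry G))
    (hper : ∀ σ, Function.Periodic (fun x => G x σ) 1)
    (h : ∀ n m : ℕ, 0 < m → m < n → ∑ l ∈ Finset.range n, G (l * (m / n)) (m / n) = 0)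
    {σ : ℝ} (hσ : σ ∈ Ioo (0 : ℝ) 1) : ∫ x in (0 : ℝ)..1, G x σ = 0 := by
  refine norm_le_zero_iff.1 (le_of_forall_pos_le_add fun ε hε => ?_)
  rw [zero_add]
  have hcomp : IsCompact (Icc (0 : ℝ) 1 ×ˢ Icc (0 : ℝ) 1) := isCompact_Icc.prod isCompact_Icc
  obtain ⟨δ, hδ, hunif⟩ := Metric.uniformContinuousOn_iff.1
    (hcomp.uniformContinuousOn_of_continuous hG.continuousOn) ε hε
  obtain ⟨N, hN⟩ := exists_nat_gt (max (1 / δ) (1 / σ))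
  obtain ⟨q, hNq, hq⟩ := Nat.exists_infinite_primes N
  have hNq' : (N : ℝ) ≤ q := by exact_mod_cast hNq
  have hq0 : (0 : ℝ) < q := by exact_mod_cast hq.pos
  have hqδ : 1 / (q : ℝ) < δ := by
    rw [one_div_lt hq0 hδ]
    exact (le_max_left _ _).trans_lt (hN.trans_le hNq')
  have hqσ : 1 < q * σ := by
    rw [← div_lt_iff₀ hσ.1]
    exact (le_max_right _ _).trans_lt (hN.trans_le hNq')
  set m := ⌊q * σ⌋₊ with hm
  have hm0 : 0 < m := Nat.floor_pos.2 hqσ.le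
  have hmle : (m : ℝ) ≤ q * σ := Nat.floor_le (by linarith)
  have hmlt : q * σ < m + 1 := Nat.lt_floor_add_one _
  have hmq : m < q := by
    have : (m : ℝ) < q := by nlinarith [hσ.2]
    exact_mod_cast this
  set τ : ℝ := m / q with hτ
  have hτ0 : 0 ≤ τ := by positivity
  have hτσ : τ ≤ σ := by rw [hτ, div_le_iff₀ hq0]; linarith
  have hτσ' : σ - τ < 1 / q := by
    rw [hτ, sub_lt_iff_lt_add, ← add_div, lt_div_iff₀ hq0]
    linarith
  have hzero : ∑ j ∈ Finset.range q, G (j / q) τ = 0 := by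
    rw [← sum_range_periodic_mul_div (hper τ) hq hm0 hmq]
    exact h q m hm0 hmq
  have hcont (s : ℝ) : Continuous fun x => G x s :=
    hG.comp (Continuous.prodMk_left s)
  have hlen (j : ℕ) : ((j + 1 : ℕ) : ℝ) / q - j / q = 1 / q := by
    push_cast
    ring
  have hsplit : ∫ x in (0 : ℝ)..1, G x σ =
      ∑ j ∈ Finset.range q, ∫ x in (j / q : ℝ)..((j + 1 : ℕ) / q : ℝ), (G x σ - G (j / q) τ) := by
    have h1 := intervalIntegral.sum_integral_adjacent_intervals (n := q) (μ := volume)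
      (f := fun x => G x σ) (a := fun j : ℕ => (j / q : ℝ))
      fun k _ => (hcont σ).intervalIntegrable _ _
    simp only [Nat.cast_zero, zero_div, div_self hq0.ne'] at h1
    rw [← h1]
    have h2 (j : ℕ) : ∫ x in (j / q : ℝ)..((j + 1 : ℕ) / q : ℝ), (G x σ - G (j / q) τ) =
        (∫ x in (j / q : ℝ)..((j + 1 : ℕ) / q : ℝ), G x σ) - 1 / q * G (j / q) τ := by
      rw [intervalIntegral.integral_sub ((hcont σ).intervalIntegrable _ _) (by simp),
        intervalIntegral.integral_const, hlen, smul_eq_mul]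
    simp_rw [h2]
    rw [Finset.sum_sub_distrib, ← Finset.mul_sum, hzero, mul_zero, sub_zero]
  rw [hsplit]
  calc _ ≤ ∑ j ∈ Finset.range q, ε * (1 / q) := by
        refine norm_sum_le_of_le _ fun j hj => ?_
        have hjq : (j : ℝ) + 1 ≤ q := by exact_mod_cast Finset.mem_range.1 hj
        have hle : (j / q : ℝ) ≤ ((j + 1 : ℕ) : ℝ) / q := by
          have := hlen j
          have : (0 : ℝ) < 1 / q := by positivity
          linarith
        have hle1 : ((j + 1 : ℕ) : ℝ) / q ≤ 1 := by
          rw [div_le_one hq0]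
          push_cast
          exact hjq
        have h0 : (0 : ℝ) ≤ j / q := by positivity
        have key := intervalIntegral.norm_integral_le_of_norm_le_const (C := ε)
          (a := (j / q : ℝ)) (b := ((j + 1 : ℕ) / q : ℝ)) (f := fun x => G x σ - G (j / q) τ) ?_
        · rwa [hlen, abs_of_nonneg (by positivity)] at key
        intro x hx
        rw [uIoc_of_le hle] at hx
        have hd := hunif (x, σ) ⟨⟨by linarith [hx.1], by linarith [hx.2]⟩, hσ.1.le, hσ.2.le⟩
          (j / q, τ) ⟨⟨h0, by linarith⟩, hτ0, by linarith [hσ.2]⟩ ?_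
        · exact hd.le
        · rw [Prod.dist_eq, max_lt_iff]
          simp only [Real.dist_eq]
          constructor
          · rw [abs_of_nonneg (by linarith [hx.1])]
            linarith [hlen j, hx.2]
          · rw [abs_of_nonneg (by linarith)]
            linarith
    _ = ε := by
        rw [Finset.sum_const, Finset.card_range, nsmul_eq_mul]
        field_simp

/-- A continuous function on `ℂ` whose averages over all rotations of each chord of the unit
circle vanish has vanishing mean over each circle of radius at most one around the origin. -/
lemma integral_circle_eq_zero {g : ℂ → ℝ} (hg : Continuous g)
    (h : ∀ σ ∈ Ioo (0 : ℝ) 1, ∫ x in (0 : ℝ)..1, ∫ t in (0 : ℝ)..1,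
      g (Complex.exp (2 * π * x * Complex.I) *
        ((1 - t) + t * Complex.exp (2 * π * σ * Complex.I))) = 0)
    {r : ℝ} (hr : r ∈ Icc (0 : ℝ) 1) :
    ∫ x in (0 : ℝ)..1, g (r * Complex.exp (2 * π * x * Complex.I)) = 0 := by
  set F : ℝ → ℝ := fun r => ∫ x in (0 : ℝ)..1, g (r * Complex.exp (2 * π * x * Complex.I)) with hF
  have hFc : Continuous F :=
    intervalIntegral.continuous_parametric_intervalIntegral_of_continuous'
      (by simp only [Function.uncurry_def]; fun_prop) _ _
  have hrot (w : ℂ) : ∫ x in (0 : ℝ)..1, g (Complex.exp (2 * π * x * Complex.I) * w) = F ‖w‖ := by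
    have hper : Function.Periodic
        (fun x : ℝ => g (‖w‖ * Complex.exp (2 * π * x * Complex.I))) 1 := by
      intro x
      simp only
      congr 2
      rw [← Complex.exp_periodic (2 * π * x * Complex.I)]
      congr 1
      push_cast
      ring
    have h1 := hper.intervalIntegral_add_eq (Complex.arg w / (2 * π)) 0
    rw [zero_add] at h1
    rw [hF]
    simp only
    rw [← h1, add_comm, ← zero_add (Complex.arg w / (2 * π)), ← add_assoc, add_zero,
      ← intervalIntegral.integral_comp_add_right]
    congr 1
    ext x
    congr 1
    conv_lhs => rw [← Complex.norm_mul_exp_arg_mul_I w]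
    rw [mul_left_comm, ← Complex.exp_add]
    congr 2
    push_cast
    field_simp
  have hK : ∀ y ∈ Icc (0 : ℝ) 1, F √(1 - y) = 0 := by
    refine eq_zero_of_parabolic_averages (K := fun y => F √(1 - y)) (by fun_prop) fun a ha => ?_
    set s := Real.arccos (1 - 2 * a) with hs
    have hcos : Real.cos s = 1 - 2 * a := Real.cos_arccos (by linarith [ha.2]) (by linarith [ha.1])
    have hs0 : 0 < s := Real.arccos_pos.2 (by linarith [ha.1])
    have hsπ : s ≤ π := Real.arccos_le_pi _
    have hσ : s / (2 * π) ∈ Ioo (0 : ℝ) 1 := by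
      refine ⟨by positivity, ?_⟩
      rw [div_lt_one (by positivity)]
      linarith [Real.pi_pos]
    have h1 := h _ hσ
    rw [intervalIntegral_intervalIntegral_swap] at h1
    · rw [← h1]
      congr 1
      ext t
      rw [hrot]
      congr 1
      have h2 : (2 * π * ((s / (2 * π) : ℝ) : ℂ) * Complex.I) = s * Complex.I := by
        push_cast
        field_simp
      rw [h2, Complex.exp_mul_I, Complex.norm_def, Complex.normSq_apply]
      congr 1
      simp [← Complex.ofReal_cos, ← Complex.ofReal_sin]
      rw [hcos]
      have := Real.sin_sq_add_cos_sq s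
      rw [hcos] at this
      linear_combination (-t ^ 2) * this
    · refine (ContinuousOn.integrableOn_compact (isCompact_uIcc.prod isCompact_uIcc) ?_).mono_set
        (prod_mono uIoc_subset_uIcc uIoc_subset_uIcc)
      simp only [Function.uncurry_def]
      fun_prop
  have := hK (1 - r ^ 2) ⟨by nlinarith [hr.1, hr.2], by nlinarith [hr.1]⟩
  rwa [sub_sub_cancel, Real.sqrt_sq hr.1] at this

/-- The isometric parametrization by `ℂ` of the plane spanned by two orthonormal vectors. -/
lemma exists_planeIsometry {E : Type*} [NormedAddCommGroup E] [InnerProductSpace ℝ E] {p v : E}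
    (hp : ‖p‖ = 1) (hv : ‖v‖ = 1) (hpv : ⟪p, v⟫ = 0) :
    ∃ ι : ℂ →ₗᵢ[ℝ] E, ∀ z, ι z = z.re • p + z.im • v := by
  refine ⟨⟨⟨⟨fun z => z.re • p + z.im • v, fun x y => ?_⟩, fun c x => ?_⟩, fun z => ?_⟩,
    fun z => rfl⟩
  · simp only [Complex.add_re, Complex.add_im]
    module
  · simp only [Complex.real_smul, Complex.re_ofReal_mul, Complex.im_ofReal_mul, RingHom.id_apply]
    module
  · rw [← sq_eq_sq₀ (norm_nonneg _) (norm_nonneg _)]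
    simp only [LinearMap.coe_mk, AddHom.coe_mk]
    rw [norm_add_sq_real, real_inner_smul_left, real_inner_smul_right, hpv, norm_smul, norm_smul,
      hp, hv, Complex.sq_norm, Complex.normSq_apply, Real.norm_eq_abs, Real.norm_eq_abs]
    simp only [mul_one, sq_abs, mul_zero, add_zero]
    ring

/-- A continuous function on the closed unit disk extends continuously to the plane. -/
lemma exists_continuous_extension_disk {g : ℂ → ℝ} (hg : ContinuousOn g (Metric.closedBall 0 1)) :
    ∃ g' : ℂ → ℝ, Continuous g' ∧ ∀ z, ‖z‖ ≤ 1 → g' z = g z := by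
  obtain ⟨g', hg'⟩ := ContinuousMap.exists_restrict_eq Metric.isClosed_closedBall
    ⟨_, hg.domRestrict⟩
  refine ⟨g', g'.continuous, fun z hz => ?_⟩
  exact DFunLike.congr_fun hg' ⟨z, by simpa using hz⟩

lemma exp_two_pi_mul_I_ne_one {σ : ℝ} (hσ : σ ∈ Ioo (0 : ℝ) 1) :
    Complex.exp (2 * π * σ * Complex.I) ≠ 1 := by
  rw [Ne, Complex.exp_eq_one_iff]
  rintro ⟨k, hk⟩
  have h1 : (σ : ℂ) = k := by
    have : (2 * π * Complex.I : ℂ) ≠ 0 := Complex.two_pi_I_ne_zero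
    refine mul_left_cancel₀ this ?_
    linear_combination hk
  have h2 : σ = k := by exact_mod_cast h1
  rw [h2] at hσ
  have h3 : 0 < k := by exact_mod_cast hσ.1
  have h4 : k < 1 := by exact_mod_cast hσ.2
  omega

lemma segInt_isometry {d : ℕ} {f : EuclideanSpace ℝ (Fin d) → ℝ} {g : ℂ → ℝ}
    (ι : ℂ →ₗᵢ[ℝ] EuclideanSpace ℝ (Fin d)) (hg : ∀ z, ‖z‖ ≤ 1 → g z = f (ι z))
    {a b : ℂ} (ha : ‖a‖ ≤ 1) (hb : ‖b‖ ≤ 1) :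
    segInt f (ι a) (ι b) = ‖b - a‖ * ∫ t in (0 : ℝ)..1, g ((1 - t) * a + t * b) := by
  rw [segInt, ← map_sub, ι.norm_map]
  congr 1
  refine intervalIntegral.integral_congr fun t ht => ?_
  rw [uIcc_of_le zero_le_one] at ht
  have hz : ((1 - t) * a + t * b : ℂ) = (1 - t) • a + t • b := by
    simp [Complex.real_smul]
  have hle : ‖(1 - t) • a + t • b‖ ≤ 1 := by
    have := (convex_closedBall (0 : ℂ) 1) (x := a) (by simpa using ha) (y := b) (by simpa using hb)
      (by linarith [ht.2] : 0 ≤ 1 - t) ht.1 (by ring)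
    simpa using this
  rw [hz, hg _ hle, map_add, map_smul, map_smul]

/-- Singleton tomography at a boundary point `p` of the unit ball in `ℝ^d`
(`d ≥ 2`) determines the integral of a continuous function over any circle centered at the
origin in a plane through `p` and the origin. -/
theorem stmt1 (d : ℕ) (hd : 2 ≤ d) (f : EuclideanSpace ℝ (Fin d) → ℝ)
    (hf : ContinuousOn f (Metric.closedBall 0 1))
    (p v : EuclideanSpace ℝ (Fin d)) (hp : ‖p‖ = 1) (hv : ‖v‖ = 1) (hpv : ⟪p, v⟫ = 0)
    (h : ∀ n : ℕ, 1 ≤ n → ∀ m : ℤ,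
      ∑ l ∈ Finset.range n,
        segInt f
          (Real.cos ((l : ℝ) * (2 * π * m / n)) • p + Real.sin ((l : ℝ) * (2 * π * m / n)) • v)
          (Real.cos (((l : ℝ) + 1) * (2 * π * m / n)) • p +
            Real.sin (((l : ℝ) + 1) * (2 * π * m / n)) • v) = 0) :
    ∀ r ∈ Set.Icc (0:ℝ) 1,
      ∫ θ in (0:ℝ)..(2 * π), f ((r * Real.cos θ) • p + (r * Real.sin θ) • v) = 0 := by
  obtain ⟨ι, hι⟩ := exists_planeIsometry hp hv hpv
  obtain ⟨g, hgc, hgf⟩ := exists_continuous_extension_disk (g := f ∘ ι)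
    (hf.comp ι.continuous.continuousOn fun z hz => by simpa using hz)
  have hexp (x : ℝ) : Complex.exp (2 * π * x * Complex.I) =
      Complex.exp ((2 * π * x : ℝ) * Complex.I) := by push_cast; rfl
  have hιexp (r x : ℝ) : ι (r * Complex.exp (x * Complex.I)) =
      (r * Real.cos x) • p + (r * Real.sin x) • v := by
    rw [hι, Complex.re_ofReal_mul, Complex.im_ofReal_mul, Complex.exp_ofReal_mul_I_re,
      Complex.exp_ofReal_mul_I_im]
  have hιexp' (x : ℝ) : ι (Complex.exp (x * Complex.I)) = Real.cos x • p + Real.sin x • v := by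
    simpa using hιexp 1 x
  intro r hr
  have hmean : ∀ σ ∈ Ioo (0 : ℝ) 1, ∫ x in (0 : ℝ)..1, ∫ t in (0 : ℝ)..1,
      g (Complex.exp (2 * π * x * Complex.I) *
        ((1 - t) + t * Complex.exp (2 * π * σ * Complex.I))) = 0 := by
    intro σ hσ
    refine integral_eq_zero_of_orbit_sums
      (G := fun x σ => ∫ t in (0 : ℝ)..1, g (Complex.exp (2 * π * x * Complex.I) *
        ((1 - t) + t * Complex.exp (2 * π * σ * Complex.I)))) ?_ ?_ ?_ hσ
    · exact intervalIntegral.continuous_parametric_intervalIntegral_of_continuous'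
        (f := fun (y : ℝ × ℝ) (t : ℝ) => g (Complex.exp (2 * π * y.1 * Complex.I) *
          ((1 - t) + t * Complex.exp (2 * π * y.2 * Complex.I))))
        (by simp only [Function.uncurry_def]; fun_prop) _ _
    · intro σ x
      have : Complex.exp (2 * π * (x + 1 : ℝ) * Complex.I) =
          Complex.exp (2 * π * x * Complex.I) := by
        rw [← Complex.exp_periodic (2 * π * x * Complex.I)]
        congr 1
        push_cast
        ring
      simp only [this]
    · intro n m hm hmn
      have hn : (0 : ℝ) < n := by exact_mod_cast hm.trans hmn
      have hσ' : (m / n : ℝ) ∈ Ioo (0 : ℝ) 1 :=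
        ⟨by positivity, by rw [div_lt_one hn]; exact_mod_cast hmn⟩
      have hsum := h n (by omega) m
      have hterm (l : ℕ) : segInt f
          (Real.cos ((l : ℝ) * (2 * π * (m : ℤ) / n)) • p +
            Real.sin ((l : ℝ) * (2 * π * (m : ℤ) / n)) • v)
          (Real.cos (((l : ℝ) + 1) * (2 * π * (m : ℤ) / n)) • p +
            Real.sin (((l : ℝ) + 1) * (2 * π * (m : ℤ) / n)) • v) =
          ‖Complex.exp (2 * π * (m / n : ℝ) * Complex.I) - 1‖ * ∫ t in (0 : ℝ)..1,
            g (Complex.exp (2 * π * (l * (m / n) : ℝ) * Complex.I) *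
              ((1 - t) + t * Complex.exp (2 * π * (m / n : ℝ) * Complex.I))) := by
        have hb : Complex.exp ((((l : ℝ) + 1) * (2 * π * (m : ℤ) / n) : ℝ) * Complex.I) =
            Complex.exp (2 * π * (l * (m / n) : ℝ) * Complex.I) *
              Complex.exp (2 * π * (m / n : ℝ) * Complex.I) := by
          rw [← Complex.exp_add]
          congr 1
          push_cast
          ring
        have ha : Complex.exp (((l : ℝ) * (2 * π * (m : ℤ) / n) : ℝ) * Complex.I) =
            Complex.exp (2 * π * (l * (m / n) : ℝ) * Complex.I) := by
          congr 1
          push_cast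
          ring
        rw [← hιexp', ← hιexp', segInt_isometry ι hgf (Complex.norm_exp_ofReal_mul_I _).le
          (Complex.norm_exp_ofReal_mul_I _).le, ha, hb]
        congr 1
        · rw [← mul_sub_one, norm_mul, hexp (l * (m / n)), Complex.norm_exp_ofReal_mul_I, one_mul]
        · congr 1
          ext t
          congr 1
          ring
      simp only [hterm] at hsum
      rw [← Finset.mul_sum] at hsum
      exact (mul_eq_zero.1 hsum).resolve_left
        (norm_ne_zero_iff.2 (sub_ne_zero.2 (exp_two_pi_mul_I_ne_one hσ')))
  have hcirc := integral_circle_eq_zero hgc hmean hr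
  have hscale := intervalIntegral.smul_integral_comp_mul_add (a := 0) (b := 1)
    (fun θ : ℝ => f ((r * Real.cos θ) • p + (r * Real.sin θ) • v)) (2 * π) 0
  simp only [mul_zero, mul_one, add_zero] at hscale
  rw [← hscale]
  refine smul_eq_zero_of_right _ ?_
  rw [← hcirc]
  congr 1
  ext x
  rw [hexp, hgf, Function.comp, hιexp]
  rw [norm_mul, Complex.norm_exp_ofReal_mul_I, Complex.norm_real, mul_one, Real.norm_eq_abs,
    abs_of_nonneg hr.1]
  exact hr.2
end

section
/- Let d ≥ 2 and let Ω ⊂ ℝ^d be a bounded open strictly convex set (for all distinct x, y ∈ Ω̄ the open segment between x and y is contained in Ω), and let E ⊂ ∂Ω be nonempty, open in the subspace topology of ∂Ω, with finitely many connected components E₁, …, E_m. Set U = co(Ω \ ⋃_{i=1}^m co(E_i)). Then for every a ∈ E there exists ε > 0 such that the open ball B(a, ε) is disjoint from U; in particular, Ω̄ \ U contains the intersection of Ω̄ with a neighborhood of E. -/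
open Real Set

/-- A ray starting in a bounded open set and with nonzero direction meets the frontier. -/
lemma exists_pos_add_smul_mem_frontier {F : Type*} [NormedAddCommGroup F] [NormedSpace ℝ F]
    {Ω : Set F} (hΩo : IsOpen Ω) (hΩb : Bornology.IsBounded Ω) {x v : F} (hx : x ∈ Ω)
    (hv : v ≠ 0) : ∃ t : ℝ, 0 < t ∧ x + t • v ∈ frontier Ω := by
  have hpre : IsPreconnected ((fun t : ℝ => x + t • v) '' Ici 0) :=
    isPreconnected_Ici.image _ (by fun_prop)
  obtain ⟨R, hR⟩ := hΩb.subset_ball x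
  have hvn : 0 < ‖v‖ := norm_pos_iff.mpr hv
  have hR0 : 0 < R := Metric.pos_of_mem_ball (hR hx)
  have hout : x + (R / ‖v‖) • v ∉ Ω := by
    intro h
    have h' := hR h
    rw [mem_ball_iff_norm, add_sub_cancel_left, norm_smul, Real.norm_of_nonneg (by positivity),
      div_mul_cancel₀ _ hvn.ne'] at h'
    exact lt_irrefl _ h'
  obtain ⟨_, ⟨t, ht, rfl⟩, hfr⟩ : (((fun t : ℝ => x + t • v) '' Ici 0) ∩ frontier Ω).Nonempty := by
    by_contra hne
    have hsub : (fun t : ℝ => x + t • v) '' Ici 0 ⊆ Ω := by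
      refine hpre.subset_left_of_subset_union hΩo isClosed_closure.isOpen_compl
        (disjoint_compl_right_iff_subset.mpr subset_closure) (fun y hy => ?_)
        ⟨x, ⟨0, by simp, by simp⟩, hx⟩
      by_cases hyΩ : y ∈ Ω
      · exact Or.inl hyΩ
      · exact Or.inr fun hcl => hne ⟨y, hy, hΩo.frontier_eq ▸ ⟨hcl, hyΩ⟩⟩
    exact hout (hsub ⟨_, mem_Ici.mpr (by positivity), rfl⟩)
  refine ⟨t, lt_of_le_of_ne ht ?_, hfr⟩
  rintro rfl
  rw [hΩo.frontier_eq] at hfr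
  exact hfr.2 (by simpa using hx)

/-- If `E` is a finite union of connected components of itself, these components are
relatively open in `E`. -/
lemma eventually_mem_connectedComponentIn {X ι : Type*} [TopologicalSpace X] [Finite ι]
    {E : Set X} {C : ι → Set X} (hC : ∀ i, ∃ x ∈ E, C i = connectedComponentIn E x)
    (hE : E = ⋃ i, C i) {a : X} (ha : a ∈ E) :
    ∀ᶠ y in nhds a, y ∈ E → y ∈ connectedComponentIn E a := by
  have key : ∀ j, ∀ᶠ y in nhds a, y ∈ C j → y ∈ connectedComponentIn E a := by
    intro j
    obtain ⟨x, hx, hj⟩ := hC j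
    by_cases hcl : a ∈ closure (C j)
    · have hpre : IsPreconnected (insert a (C j)) := by
        refine IsPreconnected.subset_closure (s := C j) ?_ (subset_insert _ _)
          (insert_subset hcl subset_closure)
        rw [hj]
        exact isPreconnected_connectedComponentIn
      have hsub : insert a (C j) ⊆ E :=
        insert_subset ha (hj ▸ connectedComponentIn_subset E x)
      exact Filter.Eventually.of_forall fun y hy =>
        hpre.subset_connectedComponentIn (mem_insert _ _) hsub (mem_insert_of_mem _ hy)
    · filter_upwards [isClosed_closure.isOpen_compl.mem_nhds hcl] with y hy hyC
      exact absurd (subset_closure hyC) hy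
  filter_upwards [Filter.eventually_all.mpr key] with y hy hyE
  rw [hE] at hyE
  obtain ⟨j, hj⟩ := mem_iUnion.mp hyE
  exact hy j hj

/-- Around a frontier point of a strictly convex set, arbitrarily small caps are cut off by
hyperplanes. -/
lemma exists_cap_subset_ball {F : Type*} [NormedAddCommGroup F] [NormedSpace ℝ F]
    [FiniteDimensional ℝ F] {Ω : Set F} (hΩo : IsOpen Ω) (hΩb : Bornology.IsBounded Ω)
    (hΩsc : ∀ x ∈ closure Ω, ∀ y ∈ closure Ω, x ≠ y → openSegment ℝ x y ⊆ Ω)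
    {a : F} (ha : a ∈ frontier Ω) {r : ℝ} (hr : 0 < r) :
    ∃ f : F →L[ℝ] ℝ, ∃ M < f a, ∀ y ∈ closure Ω, M < f y → y ∈ Metric.ball a r := by
  have hconv : Convex ℝ Ω := by
    rw [convex_iff_openSegment_subset]
    intro x hx y hy
    rcases eq_or_ne x y with rfl | hne
    · simpa using hx
    · exact hΩsc x (subset_closure hx) y (subset_closure hy) hne
  have haΩ : a ∉ Ω := by
    rw [hΩo.frontier_eq] at ha
    exact ha.2
  have hacl : a ∈ closure Ω := frontier_subset_closure ha
  obtain ⟨f, hf⟩ := geometric_hahn_banach_open_point hconv hΩo haΩ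
  have hle : ∀ y ∈ closure Ω, f y ≤ f a := by
    have : closure Ω ⊆ {y | f y ≤ f a} :=
      closure_minimal (fun y hy => (hf y hy).le) (isClosed_le f.continuous continuous_const)
    exact this
  have hlt : ∀ y ∈ closure Ω, y ≠ a → f y < f a := by
    intro y hy hne
    have hmid : midpoint ℝ y a ∈ Ω := hΩsc y hy a hacl hne (midpoint_mem_openSegment y a)
    have h := hf _ hmid
    rw [midpoint_eq_smul_add, map_smul, map_add, invOf_eq_inv, smul_eq_mul] at h
    linarith [hle y hy]
  refine ⟨f, ?_⟩
  have hK : IsCompact (closure Ω \ Metric.ball a r) :=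
    hΩb.isCompact_closure.diff Metric.isOpen_ball
  rcases (closure Ω \ Metric.ball a r).eq_empty_or_nonempty with h0 | hne
  · exact ⟨f a - 1, by linarith, fun y hy _ => sdiff_eq_empty.mp h0 hy⟩
  · obtain ⟨z, hz, hmax⟩ := hK.exists_isMaxOn hne f.continuous.continuousOn
    refine ⟨f z, hlt z hz.1 ?_, fun y hy hfy => ?_⟩
    · rintro rfl
      exact hz.2 (Metric.mem_ball_self hr)
    · by_contra hyr
      exact absurd (hmax ⟨hy, hyr⟩) (not_le.mpr hfy)

/-- (Second claim of proposition 1.) If `Ω ⊂ ℝ^d` is a bounded open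
strictly convex set and `E ⊆ ∂Ω` is nonempty, open in `∂Ω`, with finitely many connected
components `E₁, …, E_m`, then every point of `E` has a ball around it disjoint from
`U = co(Ω \ ⋃ᵢ co(Eᵢ))`. -/
theorem stmt5 (d : ℕ) (hd : 2 ≤ d)
    (Ω : Set (EuclideanSpace ℝ (Fin d)))
    (hΩo : IsOpen Ω) (hΩb : Bornology.IsBounded Ω)
    (hΩsc : ∀ x ∈ closure Ω, ∀ y ∈ closure Ω, x ≠ y → openSegment ℝ x y ⊆ Ω)
    (E : Set (EuclideanSpace ℝ (Fin d))) (hE : E ⊆ frontier Ω) (hEne : E.Nonempty)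
    (hEopen : ∃ V : Set (EuclideanSpace ℝ (Fin d)), IsOpen V ∧ E = V ∩ frontier Ω)
    (m : ℕ) (hm : 1 ≤ m) (Ecomp : Fin m → Set (EuclideanSpace ℝ (Fin d)))
    (hcomp : ∀ i, ∃ x ∈ E, Ecomp i = connectedComponentIn E x)
    (hcover : E = ⋃ i, Ecomp i) :
    ∀ a ∈ E, ∃ ε > (0:ℝ), Disjoint (Metric.ball a ε)
      (convexHull ℝ (Ω \ ⋃ i, convexHull ℝ (Ecomp i))) := by
  intro a ha
  obtain ⟨V, hV, hEV⟩ := hEopen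
  have haV : a ∈ V := (hEV ▸ ha : a ∈ V ∩ frontier Ω).1
  obtain ⟨r, hr, hball⟩ := Metric.eventually_nhds_iff_ball.mp
    ((eventually_mem_connectedComponentIn hcomp hcover ha).and (hV.mem_nhds haV))
  obtain ⟨f, M, hM, hcap⟩ := exists_cap_subset_ball hΩo hΩb hΩsc (hE ha) hr
  obtain ⟨i, hi⟩ : ∃ i, Ecomp i = connectedComponentIn E a := by
    obtain ⟨i, hi⟩ := mem_iUnion.mp (hcover ▸ ha : a ∈ ⋃ i, Ecomp i)
    obtain ⟨x, -, hx⟩ := hcomp i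
    exact ⟨i, hx.trans (connectedComponentIn_eq (hx ▸ hi))⟩
  have hmem : ∀ y ∈ frontier Ω, M < f y → y ∈ Ecomp i := by
    intro y hy hfy
    have h := hball y (hcap y (frontier_subset_closure hy) hfy)
    rw [hi]
    refine h.1 ?_
    rw [hEV]
    exact ⟨h.2, hy⟩
  obtain ⟨v, hfv, hv⟩ : ∃ v, f v = 0 ∧ v ≠ 0 := by
    have hker : LinearMap.ker (f : EuclideanSpace ℝ (Fin d) →ₗ[ℝ] ℝ) ≠ ⊥ := by
      apply LinearMap.ker_ne_bot_of_finrank_lt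
      simp only [Module.finrank_self, finrank_euclideanSpace_fin]
      omega
    obtain ⟨v, hv, hv0⟩ := Submodule.exists_mem_ne_zero_of_ne_bot hker
    exact ⟨v, by simpa using hv, hv0⟩
  have hsub : convexHull ℝ (Ω \ ⋃ i, convexHull ℝ (Ecomp i)) ⊆ {y | f y ≤ M} := by
    refine convexHull_min ?_ (convex_halfSpace_le f.toLinearMap.isLinear M)
    rintro x ⟨hx, hxU⟩
    rw [mem_ofPred_eq]
    by_contra! hfx
    refine hxU (mem_iUnion.mpr ⟨i, ?_⟩)
    obtain ⟨s, hs, hsx⟩ := exists_pos_add_smul_mem_frontier hΩo hΩb hx hv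
    obtain ⟨t, ht, htx⟩ := exists_pos_add_smul_mem_frontier hΩo hΩb hx (neg_ne_zero.mpr hv)
    refine segment_subset_convexHull (hmem _ hsx (by simpa [hfv] using hfx))
      (hmem _ htx (by simpa [hfv] using hfx)) ?_
    have hst : s + t ≠ 0 := by positivity
    refine ⟨t / (s + t), s / (s + t), by positivity, by positivity, by field_simp; ring, ?_⟩
    match_scalars <;> field_simp <;> ring
  obtain ⟨ε, hε, hεM⟩ := Metric.mem_nhds_iff.mp
    ((isOpen_lt continuous_const f.continuous).mem_nhds hM)
  refine ⟨ε, hε, disjoint_left.mpr fun y hy hyU => ?_⟩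
  have hle : f y ≤ M := hsub hyU
  exact (hεM hy : M < f y).not_ge hle
end

section
/- Let d ≥ 2 and let Ω ⊂ ℝ^d be a bounded open strictly convex set (for all distinct x, y ∈ Ω̄ the open segment between x and y is contained in Ω), and let E ⊂ ∂Ω be nonempty, open in ∂Ω, with finitely many connected components. Let f : Ω̄ → ℝ be continuous and suppose its restriction to Ω has the unique continuation property of quasianalytic functions: if f vanishes on some nonempty open subset of Ω, then f vanishes on all of Ω (for instance, f real-analytic on Ω has this property). If ∫_{[a,b]} f dH¹ = 0 for every pair of points a, b in the closure of E, then f = 0 on Ω̄. -/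
open Real MeasureTheory Set

theorem integrable_continuous_mul_of_bounded {X : Type*} [TopologicalSpace X] [T2Space X]
    [MeasurableSpace X] [BorelSpace X] {μ : Measure X} [IsFiniteMeasureOnCompacts μ]
    {K : Set X} (hK : IsCompact K) {G : X → ℝ} (hG : Measurable G) {C : ℝ}
    (hC : ∀ q, ‖G q‖ ≤ C) (hGK : ∀ q, q ∉ K → G q = 0) {φ : X → ℝ} (hφ : Continuous φ) :
    Integrable (fun q ↦ φ q * G q) μ := by
  have h1 : IntegrableOn G K μ :=
    Measure.integrableOn_of_bounded hK.measure_lt_top.ne hG.aestronglyMeasurable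
      (Filter.Eventually.of_forall hC)
  have h2 : IntegrableOn (fun q ↦ φ q * G q) K μ := h1.continuousOn_mul hφ.continuousOn hK
  refine (integrableOn_iff_integrable_of_support_subset fun q hq ↦ ?_).1 h2
  by_contra hqK
  exact hq (by simp [hGK q hqK])

theorem integral_continuous_mul_eq_zero_of_moments {K : Set (ℝ × ℝ)} (hK : IsCompact K)
    {H : ℝ × ℝ → ℝ} (hH : Measurable H) {C : ℝ} (hC : ∀ q, ‖H q‖ ≤ C)
    (hHK : ∀ q, q ∉ K → H q = 0) (c : ℝ)
    (hmom : ∀ k j : ℕ, ∫ q : ℝ × ℝ, q.1 ^ k * (q.2 - c) ^ j * H q = 0)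
    {φ : ℝ × ℝ → ℝ} (hφ : Continuous φ) : ∫ q, φ q * H q = 0 := by
  have hint : ∀ {ψ : ℝ × ℝ → ℝ}, Continuous ψ → Integrable (fun q ↦ ψ q * H q) :=
    fun hψ ↦ integrable_continuous_mul_of_bounded hK hH hC hHK hψ
  have hHi : Integrable H := by simpa using hint (continuous_const (y := (1 : ℝ)))
  have : CompactSpace K := isCompact_iff_compactSpace.1 hK
  let u : C(K, ℝ) := ⟨fun q ↦ q.1.1, by fun_prop⟩
  let v : C(K, ℝ) := ⟨fun q ↦ q.1.2 - c, by fun_prop⟩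
  let A : Subalgebra ℝ C(K, ℝ) := Algebra.adjoin ℝ {u, v}
  have hA : A.SeparatesPoints := by
    intro p q hpq
    by_contra! h
    have hu := h u ⟨u, Algebra.subset_adjoin (by simp), rfl⟩
    have hv := h v ⟨v, Algebra.subset_adjoin (by simp), rfl⟩
    simp only [u, v, ContinuousMap.coe_mk] at hu hv
    exact hpq (Subtype.ext (Prod.ext hu (by linarith)))
  have hext : ∀ g ∈ A, ∃ ψ : ℝ × ℝ → ℝ, Continuous ψ ∧ (∀ q : K, g q = ψ q) ∧
      ∫ q, ψ q * H q = 0 := by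
    intro g hg
    have hg' : g ∈ Submodule.span ℝ (Submonoid.closure {u, v} : Set C(K, ℝ)) := by
      rw [← Algebra.adjoin_eq_span]; exact hg
    induction hg' using Submodule.span_induction with
    | mem g hg =>
      obtain ⟨k, j, rfl⟩ := (Submonoid.mem_closure_pair _ _ _).1 ‹_›
      exact ⟨fun q ↦ q.1 ^ k * (q.2 - c) ^ j, by fun_prop, fun q ↦ by simp [u, v], hmom k j⟩
    | zero => exact ⟨0, continuous_zero, fun q ↦ by simp, by simp⟩
    | add g₁ g₂ h₁ h₂ ih₁ ih₂ =>
      rw [← Algebra.adjoin_eq_span] at h₁ h₂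
      obtain ⟨ψ₁, c₁, e₁, i₁⟩ := ih₁ h₁
      obtain ⟨ψ₂, c₂, e₂, i₂⟩ := ih₂ h₂
      refine ⟨fun q ↦ ψ₁ q + ψ₂ q, c₁.add c₂, fun q ↦ by simp [e₁, e₂], ?_⟩
      simp only [add_mul]
      rw [integral_add (hint c₁) (hint c₂), i₁, i₂, add_zero]
    | smul r g h ih =>
      rw [← Algebra.adjoin_eq_span] at h
      obtain ⟨ψ, hc, he, hi⟩ := ih h
      refine ⟨fun q ↦ r * ψ q, hc.const_mul r, fun q ↦ by simp [he], ?_⟩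
      simp only [mul_assoc]
      rw [integral_const_mul, hi, mul_zero]
  have hbound : ∀ ε > 0, |∫ q, φ q * H q| ≤ ε * ∫ q, |H q| := by
    intro ε hε
    obtain ⟨g, hg⟩ := ContinuousMap.exists_mem_subalgebra_near_continuous_of_separatesPoints
      A hA (fun q ↦ φ q) (by fun_prop) ε hε
    obtain ⟨ψ, hψ, he, hi⟩ := hext g g.2
    have : ∫ q, φ q * H q = ∫ q, (φ q - ψ q) * H q := by
      simp only [sub_mul]
      rw [integral_sub (hint hφ) (hint hψ), hi, sub_zero]
    rw [this, ← integral_const_mul]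
    refine norm_integral_le_of_norm_le (f := fun q ↦ (φ q - ψ q) * H q) (hHi.abs.const_mul ε)
      (Filter.Eventually.of_forall ?_)
    intro q
    by_cases hq : q ∈ K
    · have h := hg ⟨q, hq⟩
      rw [he, norm_sub_rev] at h
      rw [norm_mul, Real.norm_eq_abs (H q)]
      exact mul_le_mul_of_nonneg_right h.le (abs_nonneg _)
    · simp [hHK q hq]
  have hI : 0 ≤ ∫ q, |H q| := integral_nonneg fun q ↦ abs_nonneg _
  by_contra hne
  have hpos : 0 < |∫ q, φ q * H q| := abs_pos.2 hne
  have h := hbound (|∫ q, φ q * H q| / (2 * ((∫ q, |H q|) + 1))) (by positivity)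
  have hlt : |∫ q, φ q * H q| / (2 * ((∫ q, |H q|) + 1)) * (∫ q, |H q|)
      < |∫ q, φ q * H q| := by
    rw [div_mul_eq_mul_div, div_lt_iff₀ (by positivity)]
    nlinarith
  linarith

theorem ae_eq_zero_of_moments {K : Set (ℝ × ℝ)} (hK : IsCompact K)
    {H : ℝ × ℝ → ℝ} (hH : Measurable H) {C : ℝ} (hC : ∀ q, ‖H q‖ ≤ C)
    (hHK : ∀ q, q ∉ K → H q = 0) (c : ℝ)
    (hmom : ∀ k j : ℕ, ∫ q : ℝ × ℝ, q.1 ^ k * (q.2 - c) ^ j * H q = 0) :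
    ∀ᵐ q, H q = 0 := by
  have hHi : Integrable H := by
    simpa using integrable_continuous_mul_of_bounded (μ := volume) hK hH hC hHK
      (continuous_const (y := (1 : ℝ)))
  refine ae_eq_zero_of_integral_contDiff_smul_eq_zero hHi.locallyIntegrable fun g hg _ ↦ ?_
  simpa using integral_continuous_mul_eq_zero_of_moments hK hH hC hHK c hmom hg.continuous

theorem hasDerivAt_max_zero_pow (j : ℕ) (t : ℝ) :
    HasDerivAt (fun s : ℝ ↦ max s 0 ^ (j + 2)) ((j + 2) * max t 0 ^ (j + 1)) t := by
  rcases lt_trichotomy t 0 with h | rfl | h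
  · have h0 : HasDerivAt (fun _ : ℝ ↦ (0 : ℝ)) 0 t := hasDerivAt_const t 0
    rw [max_eq_right h.le, zero_pow (by omega), mul_zero]
    refine h0.congr_of_eventuallyEq ?_
    filter_upwards [Iio_mem_nhds h] with s hs
    rw [max_eq_right (le_of_lt hs), zero_pow (by omega)]
  · rw [max_self, zero_pow (by omega), mul_zero, hasDerivAt_iff_isLittleO]
    have h1 : (fun s : ℝ ↦ s ^ (j + 2)) =o[nhds 0] fun s ↦ s := by
      simpa using Asymptotics.isLittleO_pow_pow (𝕜 := ℝ) (m := 1) (n := j + 2) (by omega)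
    refine (Asymptotics.IsBigO.of_bound 1 (Filter.Eventually.of_forall fun s ↦ ?_)).trans_isLittleO
      (by simpa using h1)
    simp only [max_self, sub_zero, smul_zero, one_mul, norm_pow]
    rw [zero_pow (by omega), sub_zero, norm_pow]
    gcongr
    rw [Real.norm_eq_abs, Real.norm_eq_abs, abs_of_nonneg (le_max_right _ _)]
    exact max_le (le_abs_self s) (abs_nonneg s)
  · rw [max_eq_left h.le]
    have h0 := hasDerivAt_pow (j + 2) t
    push_cast at h0
    refine HasDerivAt.congr_of_eventuallyEq (by simpa using h0) ?_
    filter_upwards [Ioi_mem_nhds h] with s hs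
    rw [max_eq_left (le_of_lt hs)]

theorem hasDerivAt_shear_moment {K : Set (ℝ × ℝ)} (hK : IsCompact K)
    {G : ℝ × ℝ → ℝ} (hG : Measurable G) {C : ℝ} (hC : ∀ q, ‖G q‖ ≤ C)
    (hGK : ∀ q, q ∉ K → G q = 0) (c : ℝ) (k j : ℕ) (a : ℝ) :
    HasDerivAt (fun a ↦ ∫ q : ℝ × ℝ, q.1 ^ k * max (q.2 - c - a * q.1) 0 ^ (j + 2) * G q)
      (-(j + 2) * ∫ q : ℝ × ℝ, q.1 ^ (k + 1) * max (q.2 - c - a * q.1) 0 ^ (j + 1) * G q) a := by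
  have hint : ∀ {ψ : ℝ × ℝ → ℝ}, Continuous ψ → Integrable (fun q ↦ ψ q * G q) :=
    fun hψ ↦ integrable_continuous_mul_of_bounded hK hG hC hGK hψ
  let D : ℝ → ℝ × ℝ → ℝ := fun a q ↦
    -(j + 2) * (q.1 ^ (k + 1) * max (q.2 - c - a * q.1) 0 ^ (j + 1))
  have hD : Continuous fun p : ℝ × (ℝ × ℝ) ↦ D p.1 p.2 := by fun_prop
  obtain ⟨M, hM⟩ := ((isCompact_closedBall a 1).prod hK).exists_bound_of_continuousOn
    hD.continuousOn
  have hGi : Integrable G := by simpa using hint (continuous_const (y := (1 : ℝ)))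
  rw [← integral_const_mul]
  have key := (hasDerivAt_integral_of_dominated_loc_of_deriv_le (μ := (volume : Measure (ℝ × ℝ)))
    (F := fun a q ↦ q.1 ^ k * max (q.2 - c - a * q.1) 0 ^ (j + 2) * G q)
    (F' := fun a q ↦ D a q * G q) (bound := fun q ↦ M * ‖G q‖)
    (Metric.closedBall_mem_nhds a one_pos)
    (Filter.Eventually.of_forall fun x ↦ (hint (by fun_prop)).aestronglyMeasurable)
    (hint (by fun_prop)) (hint (by fun_prop)).aestronglyMeasurable
    (Filter.Eventually.of_forall fun q x hx ↦ ?_) (hGi.norm.const_mul M)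
    (Filter.Eventually.of_forall fun q x hx ↦ ?_)).2
  · refine key.congr_deriv ?_
    simp only [D, mul_assoc]
  · by_cases hq : q ∈ K
    · rw [norm_mul]
      exact mul_le_mul_of_nonneg_right (hM (x, q) ⟨hx, hq⟩) (norm_nonneg _)
    · simp [hGK q hq]
  · have h1 : HasDerivAt (fun x : ℝ ↦ q.2 - c - x * q.1) (-q.1) x := by
      simpa using ((hasDerivAt_id x).mul_const q.1).const_sub (q.2 - c)
    have h2 := (((hasDerivAt_max_zero_pow j (q.2 - c - x * q.1)).comp x h1).const_mul
      (q.1 ^ k)).mul_const (G q)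
    refine h2.congr_deriv ?_
    simp only [D]
    ring

theorem integral_shear_eq_zero {K : Set (ℝ × ℝ)} (hK : IsCompact K)
    {G : ℝ × ℝ → ℝ} (hG : Measurable G) {C : ℝ} (hC : ∀ q, ‖G q‖ ≤ C)
    (hGK : ∀ q, q ∉ K → G q = 0) {c a : ℝ}
    (hline : ∀ b > c, ∫ x, G (x, b + a * x) = 0) (N : ℕ) :
    ∫ q : ℝ × ℝ, max (q.2 - c - a * q.1) 0 ^ (N + 1) * G q = 0 := by
  let e : ℝ × ℝ ≃ₜ ℝ × ℝ :=
    { toFun := fun q ↦ (q.1, q.2 + a * q.1)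
      invFun := fun q ↦ (q.1, q.2 - a * q.1)
      left_inv := fun q ↦ by simp
      right_inv := fun q ↦ by simp
      continuous_toFun := by fun_prop
      continuous_invFun := by fun_prop }
  have hint := integrable_continuous_mul_of_bounded (μ := volume)
    (e.isClosedEmbedding.isCompact_preimage hK) (hG.comp e.continuous.measurable)
    (fun q ↦ hC (e q)) (fun q hq ↦ hGK (e q) hq)
    (φ := fun q ↦ max (q.2 - c) 0 ^ (N + 1)) (by fun_prop)
  have hint' := integrable_continuous_mul_of_bounded (μ := volume) hK hG hC hGK
    (φ := fun q ↦ max (q.2 - c - a * q.1) 0 ^ (N + 1)) (by fun_prop)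
  rw [Measure.volume_eq_prod] at hint hint' ⊢
  rw [integral_prod _ hint']
  have hshift : ∀ x : ℝ, ∫ y, max (y - c - a * x) 0 ^ (N + 1) * G (x, y)
      = ∫ b, max (b - c) 0 ^ (N + 1) * G (x, b + a * x) := by
    intro x
    rw [← integral_add_right_eq_self _ (a * x)]
    refine integral_congr_ae (Filter.Eventually.of_forall fun b ↦ ?_)
    simp only
    rw [show b + a * x - c - a * x = b - c by ring]
  simp only [hshift]
  rw [integral_integral_swap hint]
  refine integral_eq_zero_of_ae (Filter.Eventually.of_forall fun b ↦ ?_)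
  change ∫ x, max (b - c) 0 ^ (N + 1) * G (x, b + a * x) = 0
  rw [integral_const_mul]
  rcases le_or_gt b c with h | h
  · rw [max_eq_right (by linarith), zero_pow (by omega), zero_mul]
  · rw [hline b h, mul_zero]

/-- A local support theorem for the planar X-ray transform: a bounded compactly supported function
whose integrals vanish along all lines `y = b + a x` of small slope `a` and with `b > c` vanishes
almost everywhere above height `c`. -/
theorem ae_eq_zero_of_line_integrals {K : Set (ℝ × ℝ)} (hK : IsCompact K)
    {G : ℝ × ℝ → ℝ} (hG : Measurable G) {C : ℝ} (hC : ∀ q, ‖G q‖ ≤ C)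
    (hGK : ∀ q, q ∉ K → G q = 0) {c δ : ℝ} (hδ : 0 < δ)
    (hline : ∀ a, |a| < δ → ∀ b > c, ∫ x, G (x, b + a * x) = 0) :
    ∀ᵐ q : ℝ × ℝ, c < q.2 → G q = 0 := by
  have hshear : ∀ k j : ℕ, ∀ a, |a| < δ →
      ∫ q : ℝ × ℝ, q.1 ^ k * max (q.2 - c - a * q.1) 0 ^ (j + 1) * G q = 0 := by
    intro k
    induction k with
    | zero =>
      intro j a ha
      simpa using integral_shear_eq_zero hK hG hC hGK (hline a ha) j
    | succ k ih =>
      intro j a ha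
      have h1 := hasDerivAt_shear_moment hK hG hC hGK c k j a
      have h2 : HasDerivAt
          (fun a ↦ ∫ q : ℝ × ℝ, q.1 ^ k * max (q.2 - c - a * q.1) 0 ^ (j + 2) * G q) 0 a := by
        refine (hasDerivAt_const a (0 : ℝ)).congr_of_eventuallyEq ?_
        filter_upwards [(isOpen_lt continuous_abs continuous_const).mem_nhds ha] with x hx
        exact ih (j + 1) x hx
      have h3 := h1.unique h2
      have h4 : (-((j : ℝ) + 2)) ≠ 0 := by
        have : (0 : ℝ) < (j : ℝ) + 2 := by positivity
        exact neg_ne_zero.2 this.ne'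
      exact (mul_eq_zero.1 h3).resolve_left h4
  obtain ⟨B, hB⟩ := hK.exists_bound_of_continuousOn
    (f := fun q : ℝ × ℝ ↦ max (q.2 - c) 0) (by fun_prop)
  have hH := ae_eq_zero_of_moments hK (H := fun q ↦ max (q.2 - c) 0 * G q) (C := |B| * |C|)
    (by fun_prop) ?_ (fun q hq ↦ by simp [hGK q hq]) c ?_
  · filter_upwards [hH] with q hq hcq
    refine (mul_eq_zero.1 hq).resolve_left ?_
    rw [max_eq_left (by linarith)]
    linarith
  · intro q
    by_cases hq : q ∈ K
    · rw [norm_mul]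
      exact mul_le_mul ((hB q hq).trans (le_abs_self B)) ((hC q).trans (le_abs_self C))
        (norm_nonneg _) (abs_nonneg _)
    · simp only [hGK q hq, mul_zero, norm_zero]
      positivity
  · intro k j
    refine Eq.trans ?_ (hshear k j 0 (by simpa using hδ))
    refine integral_congr_ae (Filter.Eventually.of_forall fun q ↦ ?_)
    simp only [zero_mul, sub_zero]
    rcases le_or_gt (q.2 - c) 0 with h | h
    · rw [max_eq_right h, zero_pow (by omega)]
      ring
    · rw [max_eq_left h.le]
      ring

/-- The integral of `f` along the part of a line inside `closure Ω`, when the end points of that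
part lie in a set all of whose chords have vanishing integral. -/
theorem integral_indicator_line_eq_zero {d : ℕ} {Ω : Set (EuclideanSpace ℝ (Fin d))}
    (hΩo : IsOpen Ω) (hΩb : Bornology.IsBounded Ω) (hΩc : Convex ℝ (closure Ω))
    {f : EuclideanSpace ℝ (Fin d) → ℝ} {w v : EuclideanSpace ℝ (Fin d)} (hv : v ≠ 0)
    (hint : ∀ s t : ℝ, w + s • v ∈ frontier Ω → w + t • v ∈ frontier Ω →
      segInt f (w + s • v) (w + t • v) = 0) :
    ∫ x : ℝ, (closure Ω).indicator f (w + x • v) = 0 := by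
  have hcont : Continuous fun x : ℝ ↦ w + x • v := by fun_prop
  set S : Set ℝ := (fun x : ℝ ↦ w + x • v) ⁻¹' closure Ω
  have hSclosed : IsClosed S := isClosed_closure.preimage hcont
  have hSbdd : Bornology.IsBounded S := by
    obtain ⟨R, hR⟩ := hΩb.closure.exists_norm_le
    refine isBounded_iff_forall_norm_le.2 ⟨(R + ‖w‖) / ‖v‖, fun x hx ↦ ?_⟩
    have h1 := hR _ hx
    rw [le_div_iff₀ (norm_pos_iff.2 hv), ← norm_smul]
    have h2 := norm_sub_le (w + x • v) w
    rw [add_sub_cancel_left] at h2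
    linarith
  have hScpt : IsCompact S := Metric.isCompact_of_isClosed_isBounded hSclosed hSbdd
  have hSconv : Convex ℝ S := by
    intro x hx y hy p q hp hq hpq
    have h := hΩc hx hy hp hq hpq
    change w + (p • x + q • y) • v ∈ closure Ω
    convert h using 1
    rw [smul_add, smul_add, add_add_add_comm, ← add_smul, hpq, one_smul, add_smul, smul_smul,
      smul_smul, smul_eq_mul, smul_eq_mul]
  have hind : (fun x : ℝ ↦ (closure Ω).indicator f (w + x • v))
      = S.indicator (fun x ↦ f (w + x • v)) := rfl
  rw [hind, integral_indicator hSclosed.measurableSet]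
  rcases S.eq_empty_or_nonempty with hSe | hSne
  · simp [hSe]
  have hIcc := eq_Icc_of_connected_compact ⟨hSne, hSconv.isPreconnected⟩ hScpt
  set s := sInf S
  set t := sSup S
  have hst : s ≤ t := by
    rw [hIcc] at hSne
    exact Set.nonempty_Icc.1 hSne
  have hfront : ∀ r ∈ S, (∀ O ∈ nhds r, ∃ r' ∈ O, r' ∉ S) → w + r • v ∈ frontier Ω := by
    intro r hr hO
    rw [hΩo.frontier_eq]
    refine ⟨hr, fun hmem ↦ ?_⟩
    obtain ⟨r', h1, h2⟩ := hO _ ((hΩo.preimage hcont).mem_nhds hmem)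
    exact h2 (subset_closure h1)
  have hs : w + s • v ∈ frontier Ω := by
    refine hfront s (hScpt.sInf_mem hSne) fun O hO ↦ ?_
    obtain ⟨r', h1, h2⟩ := Filter.nonempty_of_mem (Filter.inter_mem
      (mem_nhdsWithin_of_mem_nhds hO : O ∈ nhdsWithin s (Set.Iio s)) self_mem_nhdsWithin)
    refine ⟨r', h1, fun h ↦ ?_⟩
    rw [hIcc] at h
    exact absurd h.1 (not_le.2 h2)
  have ht : w + t • v ∈ frontier Ω := by
    refine hfront t (hScpt.sSup_mem hSne) fun O hO ↦ ?_
    obtain ⟨r', h1, h2⟩ := Filter.nonempty_of_mem (Filter.inter_mem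
      (mem_nhdsWithin_of_mem_nhds hO : O ∈ nhdsWithin t (Set.Ioi t)) self_mem_nhdsWithin)
    refine ⟨r', h1, fun h ↦ ?_⟩
    rw [hIcc] at h
    exact absurd h.2 (not_le.2 h2)
  rw [hIcc, integral_Icc_eq_integral_Ioc, ← intervalIntegral.integral_of_le hst]
  have hscale := intervalIntegral.smul_integral_comp_add_mul (a := 0) (b := 1)
    (fun x : ℝ ↦ f (w + x • v)) (t - s) s
  rw [mul_zero, add_zero, mul_one, add_sub_cancel] at hscale
  rw [← hscale]
  have hseg := hint s t hs ht
  rw [segInt, mul_eq_zero] at hseg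
  have hfun : (fun x : ℝ ↦ f ((1 - x) • (w + s • v) + x • (w + t • v)))
      = fun x : ℝ ↦ f (w + (s + (t - s) * x) • v) := by
    funext x
    congr 1
    module
  rw [hfun] at hseg
  rcases hseg with h | h
  · have h0 : (t - s) • v = 0 := by
      rw [sub_smul, ← norm_eq_zero, ← h]
      congr 1
      module
    rw [(smul_eq_zero.1 h0).resolve_right hv, zero_smul]
  · rw [h, smul_zero]

/-- At a boundary point of a bounded open strictly convex set there are arbitrarily small caps. -/
theorem exists_cap_subset {X : Type*} [NormedAddCommGroup X] [NormedSpace ℝ X] [ProperSpace X]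
    {Ω V : Set X} (hΩo : IsOpen Ω) (hΩb : Bornology.IsBounded Ω)
    (hΩsc : ∀ x ∈ closure Ω, ∀ y ∈ closure Ω, x ≠ y → openSegment ℝ x y ⊆ Ω)
    (hconv : Convex ℝ Ω) {p : X} (hp : p ∈ frontier Ω) (hV : IsOpen V) (hpV : p ∈ V) :
    ∃ (l : X →L[ℝ] ℝ) (r : ℝ), (∀ x ∈ Ω, l x < l p) ∧ r < l p ∧
      ∀ x ∈ closure Ω, r < l x → x ∈ V := by
  have hpΩ : p ∉ Ω := by
    rw [hΩo.frontier_eq] at hp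
    exact hp.2
  obtain ⟨l, hl⟩ := geometric_hahn_banach_open_point hconv hΩo hpΩ
  have hstrict : ∀ x ∈ closure Ω, x ≠ p → l x < l p := by
    intro x hx hxp
    have hmid : (1 / 2 : ℝ) • x + (1 / 2 : ℝ) • p ∈ Ω :=
      hΩsc x hx p (frontier_subset_closure hp) hxp
        ⟨1 / 2, 1 / 2, by norm_num, by norm_num, by norm_num, rfl⟩
    have h := hl _ hmid
    rw [map_add, map_smul, map_smul, smul_eq_mul, smul_eq_mul] at h
    linarith
  have hcpt : IsCompact (closure Ω \ V) := hΩb.isCompact_closure.diff hV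
  refine ⟨l, ?_⟩
  rcases (closure Ω \ V).eq_empty_or_nonempty with h0 | h0
  · exact ⟨l p - 1, hl, by linarith, fun x hx _ ↦ (Set.sdiff_eq_empty.1 h0) hx⟩
  · obtain ⟨y, hy, hmax⟩ := hcpt.exists_isMaxOn h0 l.continuous.continuousOn
    refine ⟨l y, hl, hstrict y hy.1 fun h ↦ hy.2 (h ▸ hpV), fun x hx hxr ↦ ?_⟩
    by_contra hxV
    exact absurd (hmax ⟨hx, hxV⟩) (not_le.2 hxr)

/-- If the integrals of `f` vanish over all chords of a convex set with both end points in a cap,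
then `f` vanishes in the cap. -/
theorem eq_zero_of_cap {d : ℕ} (hd : 2 ≤ d) {Ω : Set (EuclideanSpace ℝ (Fin d))}
    (hΩo : IsOpen Ω) (hΩb : Bornology.IsBounded Ω) (hconv : Convex ℝ Ω)
    {f : EuclideanSpace ℝ (Fin d) → ℝ} (hf : ContinuousOn f (closure Ω))
    {l : EuclideanSpace ℝ (Fin d) →L[ℝ] ℝ} (hl : l ≠ 0) {r : ℝ}
    (hint : ∀ x ∈ frontier Ω, ∀ y ∈ frontier Ω, r < l x → r < l y → segInt f x y = 0)
    {z : EuclideanSpace ℝ (Fin d)} (hz : z ∈ Ω) (hzr : r < l z) : f z = 0 := by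
  obtain ⟨e, he, he0⟩ : ∃ e, l e = 0 ∧ e ≠ 0 := by
    have h := LinearMap.ker_ne_bot_of_finrank_lt (f := (l : EuclideanSpace ℝ (Fin d) →ₗ[ℝ] ℝ))
      (by simp; omega)
    obtain ⟨e, he, he0⟩ := Submodule.exists_mem_ne_zero_of_ne_bot h
    exact ⟨e, by simpa using he, he0⟩
  obtain ⟨n, hn⟩ : ∃ n, l n = 1 := by
    obtain ⟨x, hx⟩ := DFunLike.ne_iff.1 hl
    exact ⟨(l x)⁻¹ • x, by rw [map_smul, smul_eq_mul, inv_mul_cancel₀ (by simpa using hx)]⟩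
  let T : ℝ × ℝ →ₗ[ℝ] EuclideanSpace ℝ (Fin d) :=
    (LinearMap.fst ℝ ℝ ℝ).smulRight e + (LinearMap.snd ℝ ℝ ℝ).smulRight n
  have hT : ∀ q, T q = q.1 • e + q.2 • n := fun q ↦ rfl
  have hTker : T.ker = ⊥ := by
    rw [LinearMap.ker_eq_bot']
    intro q hq
    have h2 : q.2 = 0 := by
      have := congrArg l hq
      simpa [hT, he, hn] using this
    rw [hT, h2, zero_smul, add_zero] at hq
    exact Prod.ext ((smul_eq_zero.1 hq).resolve_right he0) h2
  have hemb : Topology.IsClosedEmbedding fun q ↦ z + T q :=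
    (Homeomorph.addLeft z).isClosedEmbedding.comp (LinearMap.isClosedEmbedding_of_injective hTker)
  have hK := hemb.isCompact_preimage hΩb.isCompact_closure
  set K := (fun q ↦ z + T q) ⁻¹' closure Ω
  obtain ⟨R, hR0, hR⟩ := hK.isBounded.exists_pos_norm_le
  obtain ⟨C, hC⟩ := hΩb.isCompact_closure.exists_bound_of_continuousOn hf
  have hC0 : 0 ≤ C := (norm_nonneg _).trans (hC z (subset_closure hz))
  have hgm : Measurable ((closure Ω).indicator f) := by
    classical
    rw [← Set.piecewise_eq_indicator]
    exact hf.measurable_piecewise continuousOn_const isClosed_closure.measurableSet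
  let c := (r - l z) / 2
  have hc : c < 0 := by simp only [c]; linarith
  have hae := ae_eq_zero_of_line_integrals hK (G := fun q ↦ (closure Ω).indicator f (z + T q))
    (hgm.comp hemb.continuous.measurable) (C := C) ?_
    (fun q (hq : z + T q ∉ closure Ω) ↦ Set.indicator_of_notMem hq f) (c := c) (δ := -c / R)
    (div_pos (by linarith) hR0) ?_
  · have hUo : IsOpen ((fun q ↦ z + T q) ⁻¹' Ω ∩ {q : ℝ × ℝ | c < q.2}) :=
      (hΩo.preimage hemb.continuous).inter (isOpen_lt continuous_const continuous_snd)
    have hcont : ContinuousOn (fun q ↦ (closure Ω).indicator f (z + T q))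
        ((fun q ↦ z + T q) ⁻¹' Ω ∩ {q : ℝ × ℝ | c < q.2}) := by
      refine (hf.comp (t := closure Ω) hemb.continuous.continuousOn
        fun q hq ↦ subset_closure hq.1).congr fun q hq ↦ ?_
      have hqΩ : z + T q ∈ closure Ω := subset_closure hq.1
      exact Set.indicator_of_mem hqΩ f
    have hEq := Measure.eqOn_open_of_ae_eq (μ := volume) (g := fun _ ↦ (0 : ℝ)) ?_ hUo hcont
      continuousOn_const
    · have h0 := hEq (x := 0) ⟨by simpa using hz, hc⟩
      simpa [Set.indicator_of_mem (subset_closure hz)] using h0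
    · rw [Filter.EventuallyEq, ae_restrict_iff' hUo.measurableSet]
      filter_upwards [hae] with q hq hqU
      exact hq hqU.2
  · intro q
    by_cases hq : z + T q ∈ closure Ω
    · simpa only [Set.indicator_of_mem hq] using hC _ hq
    · simpa only [Set.indicator_of_notMem hq, norm_zero] using hC0
  · intro a ha b hb
    have hpt : ∀ x : ℝ, z + T (x, b + a * x) = (z + b • n) + x • (e + a • n) := by
      intro x
      rw [hT]
      module
    simp only [hpt]
    have hv : e + a • n ≠ 0 := by
      intro h
      have h1 : a = 0 := by simpa [he, hn] using congrArg l h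
      rw [h1, zero_smul, add_zero] at h
      exact he0 h
    have hhigh : ∀ s : ℝ, (z + b • n) + s • (e + a • n) ∈ frontier Ω →
        r < l ((z + b • n) + s • (e + a • n)) := by
      intro s hs
      have hsK : (s, b + a * s) ∈ K := by
        change z + T (s, b + a * s) ∈ closure Ω
        rw [hpt]
        exact frontier_subset_closure hs
      have hsR : |s| ≤ R := (norm_fst_le (s, b + a * s)).trans (hR _ hsK)
      have h1 : |a * s| ≤ -c := by
        rw [abs_mul]
        calc |a| * |s| ≤ (-c / R) * R :=
              mul_le_mul ha.le hsR (abs_nonneg s) ((abs_nonneg a).trans ha.le)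
          _ = -c := div_mul_cancel₀ _ hR0.ne'
      have h2 := neg_le_of_abs_le h1
      have h3 : l ((z + b • n) + s • (e + a • n)) = l z + b + a * s := by
        simp [he, hn]
        ring
      have h4 : 2 * c = r - l z := by simp only [c]; ring
      rw [h3]
      linarith
    exact integral_indicator_line_eq_zero hΩo hΩb hconv.closure hv
      fun s t hs ht ↦ hint _ hs _ ht (hhigh s hs) (hhigh t ht)

/-- (Corollary 2 of the paper.) Let `Ω ⊂ ℝ^d` be a bounded open strictly
convex set and `E ⊆ ∂Ω` nonempty, open in `∂Ω`, with finitely many connected components.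
If `f` is continuous on `Ω̄`, has the unique continuation property of quasianalytic
functions on `Ω`, and integrates to zero over every segment with endpoints in the closure
of `E`, then `f = 0` on `Ω̄`. -/
theorem stmt6 (d : ℕ) (hd : 2 ≤ d)
    (Ω : Set (EuclideanSpace ℝ (Fin d)))
    (hΩo : IsOpen Ω) (hΩb : Bornology.IsBounded Ω)
    (hΩsc : ∀ x ∈ closure Ω, ∀ y ∈ closure Ω, x ≠ y → openSegment ℝ x y ⊆ Ω)
    (E : Set (EuclideanSpace ℝ (Fin d))) (hE : E ⊆ frontier Ω) (hEne : E.Nonempty)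
    (hEopen : ∃ V : Set (EuclideanSpace ℝ (Fin d)), IsOpen V ∧ E = V ∩ frontier Ω)
    (m : ℕ) (hm : 1 ≤ m) (Ecomp : Fin m → Set (EuclideanSpace ℝ (Fin d)))
    (hcomp : ∀ i, ∃ x ∈ E, Ecomp i = connectedComponentIn E x)
    (hcover : E = ⋃ i, Ecomp i)
    (f : EuclideanSpace ℝ (Fin d) → ℝ) (hf : ContinuousOn f (closure Ω))
    (hucp : ∀ V : Set (EuclideanSpace ℝ (Fin d)), IsOpen V → V.Nonempty → V ⊆ Ω →
      (∀ x ∈ V, f x = 0) → ∀ x ∈ Ω, f x = 0)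
    (hint : ∀ a ∈ closure E, ∀ b ∈ closure E, segInt f a b = 0) :
    ∀ x ∈ closure Ω, f x = 0 := by
  obtain ⟨V, hVo, rfl⟩ := hEopen
  obtain ⟨p, hpV, hp⟩ := hEne
  have hconv : Convex ℝ Ω := by
    refine convex_iff_openSegment_subset.2 fun x hx y hy ↦ ?_
    rcases eq_or_ne x y with rfl | hxy
    · rw [openSegment_same]
      exact Set.singleton_subset_iff.2 hx
    · exact hΩsc x (subset_closure hx) y (subset_closure hy) hxy
  obtain ⟨l, r, hl, hr, hcap⟩ := exists_cap_subset hΩo hΩb hΩsc hconv hp hVo hpV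
  obtain ⟨y, hy, hyΩ⟩ := mem_closure_iff.1 (frontier_subset_closure hp) {x | r < l x}
    (isOpen_lt continuous_const l.continuous) hr
  have hl0 : l ≠ 0 := by
    rintro rfl
    simpa using hl y hyΩ
  have hmem : ∀ x ∈ frontier Ω, r < l x → x ∈ closure (V ∩ frontier Ω) := fun x hx hxr ↦
    subset_closure ⟨hcap x (frontier_subset_closure hx) hxr, hx⟩
  have hzero : ∀ x ∈ Ω, f x = 0 := by
    refine hucp (Ω ∩ {x | r < l x}) (hΩo.inter (isOpen_lt continuous_const l.continuous))
      ⟨y, hyΩ, hy⟩ Set.inter_subset_left fun x hx ↦ ?_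
    exact eq_zero_of_cap hd hΩo hΩb hconv hf hl0
      (fun x hx y hy hxr hyr ↦ hint x (hmem x hx hxr) y (hmem y hy hyr)) hx.1 hx.2
  have hEq : Set.EqOn f (fun _ ↦ 0) (closure Ω) :=
    Set.EqOn.of_subset_closure hzero hf continuousOn_const subset_closure subset_rfl
  exact fun x hx ↦ hEq hx
end

section
/- Let k ≥ 0 be an integer and let f : [0,1] → ℝ be continuous, with f(0) = 0 if k ≥ 1. Then the generalized Abel transform A_k f is a continuous function on [0,1]. -/
open Real MeasureTheory Set

/-- The `k`-th generalized Abel transform: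
`A_k f(z) = 2 ∫_z^1 T_k(z/y) f(y) (1 − (z/y)²)^{−1/2} dy` (and `A_k f(1) = 0`). -/
noncomputable def abel (k : ℕ) (f : ℝ → ℝ) (z : ℝ) : ℝ :=
  2 * ∫ y in z..1,
    (Polynomial.Chebyshev.T ℝ k).eval (z / y) * f y / Real.sqrt (1 - (z / y) ^ 2)

/-- For fixed `z`, the substitution removing the square-root singularity of the Abel kernel. -/
noncomputable def abelSubst (z t : ℝ) : ℝ := √(z ^ 2 + (1 - z ^ 2) * t ^ 2)

lemma continuous_abelSubst : Continuous fun p : ℝ × ℝ => abelSubst p.1 p.2 := by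
  unfold abelSubst
  fun_prop

lemma abelSubst_radicand_pos (z : ℝ) {t : ℝ} (ht : t ∈ Ioo (0 : ℝ) 1) :
    0 < z ^ 2 + (1 - z ^ 2) * t ^ 2 := by
  have h1 : 0 < t ^ 2 := pow_pos ht.1 2
  have h2 : t ^ 2 < 1 := by nlinarith [ht.1, ht.2]
  nlinarith [mul_nonneg (sq_nonneg z) (sub_nonneg.2 h2.le)]

lemma abelSubst_pos (z : ℝ) {t : ℝ} (ht : t ∈ Ioo (0 : ℝ) 1) :
    0 < abelSubst z t :=
  Real.sqrt_pos.2 (abelSubst_radicand_pos z ht)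

lemma abelSubst_sq (z : ℝ) {t : ℝ} (ht : t ∈ Ioo (0 : ℝ) 1) :
    abelSubst z t ^ 2 = z ^ 2 + (1 - z ^ 2) * t ^ 2 :=
  Real.sq_sqrt (abelSubst_radicand_pos z ht).le

lemma le_abelSubst {z t : ℝ} (hz : z ∈ Icc (0 : ℝ) 1) : z ≤ abelSubst z t := by
  apply Real.le_sqrt_of_sq_le
  have : 0 ≤ 1 - z ^ 2 := by nlinarith [hz.1, hz.2]
  nlinarith [mul_nonneg this (sq_nonneg t)]

lemma abelSubst_le_one {z t : ℝ} (hz : z ∈ Icc (0 : ℝ) 1) (ht : t ∈ Ioo (0 : ℝ) 1) :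
    abelSubst z t ≤ 1 := by
  refine Real.sqrt_le_iff.2 ⟨zero_le_one, ?_⟩
  have h1 : 0 ≤ 1 - z ^ 2 := by nlinarith [hz.1, hz.2]
  have h2 : t ^ 2 ≤ 1 := by nlinarith [ht.1, ht.2]
  nlinarith [mul_nonneg h1 (sub_nonneg.2 h2)]

lemma hasDerivAt_abelSubst (z : ℝ) {t : ℝ} (ht : t ∈ Ioo (0 : ℝ) 1) :
    HasDerivAt (abelSubst z) ((1 - z ^ 2) * t / abelSubst z t) t := by
  have h := ((((hasDerivAt_id t).pow 2).const_mul (1 - z ^ 2)).const_add (z ^ 2)).sqrt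
    (abelSubst_radicand_pos z ht).ne'
  convert h using 1
  · rfl
  · have h0 := (abelSubst_pos z ht).ne'
    unfold abelSubst at h0 ⊢
    simp only [id, Pi.pow_apply]
    field_simp
    push_cast
    ring

lemma injOn_abelSubst {z : ℝ} (hz : z ∈ Ico (0 : ℝ) 1) : InjOn (abelSubst z) (Ioo 0 1) := by
  intro s hs t ht h
  have h1 : 0 < 1 - z ^ 2 := by nlinarith [hz.1, hz.2]
  have h2 := abelSubst_sq z hs
  rw [h, abelSubst_sq z ht] at h2
  have h3 : s ^ 2 = t ^ 2 := mul_left_cancel₀ h1.ne' (by linarith)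
  exact (pow_left_inj₀ hs.1.le ht.1.le two_ne_zero).1 h3

lemma image_abelSubst {z : ℝ} (hz : z ∈ Ico (0 : ℝ) 1) : abelSubst z '' Ioo 0 1 = Ioo z 1 := by
  have h1 : 0 < 1 - z ^ 2 := by nlinarith [hz.1, hz.2]
  ext y
  constructor
  · rintro ⟨t, ht, rfl⟩
    have h2 := abelSubst_sq z ht
    have h3 : 0 < t ^ 2 := pow_pos ht.1 2
    have h4 : t ^ 2 < 1 := by nlinarith [ht.1, ht.2]
    have h5 := abelSubst_pos z ht
    constructor
    · nlinarith [mul_pos h1 h3, hz.1]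
    · nlinarith [mul_pos h1 (sub_pos.2 h4)]
  · rintro ⟨hy, hy1⟩
    have hy0 : 0 < y := hz.1.trans_lt hy
    have hq : 0 < (y ^ 2 - z ^ 2) / (1 - z ^ 2) := div_pos (by nlinarith [hz.1]) h1
    refine ⟨√((y ^ 2 - z ^ 2) / (1 - z ^ 2)), ⟨Real.sqrt_pos.2 hq, ?_⟩, ?_⟩
    · rw [Real.sqrt_lt' one_pos, div_lt_iff₀ h1]
      nlinarith
    · rw [abelSubst, Real.sq_sqrt hq.le, mul_div_cancel₀ _ h1.ne', add_sub_cancel,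
        Real.sqrt_sq hy0.le]

lemma sqrt_one_sub_div_abelSubst {z t : ℝ} (hz : z ∈ Icc (0 : ℝ) 1) (ht : t ∈ Ioo (0 : ℝ) 1) :
    √(1 - (z / abelSubst z t) ^ 2) = √(1 - z ^ 2) * t / abelSubst z t := by
  have h1 : 0 ≤ 1 - z ^ 2 := by nlinarith [hz.1, hz.2]
  have h2 := abelSubst_pos z ht
  have ht0 := ht.1
  have h3 : 1 - (z / abelSubst z t) ^ 2 = (√(1 - z ^ 2) * t / abelSubst z t) ^ 2 := by
    rw [div_pow, div_pow, mul_pow, Real.sq_sqrt h1, one_sub_div (by positivity),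
      abelSubst_sq z ht, add_sub_cancel_left]
  rw [h3, Real.sqrt_sq (by positivity)]

/-- The Abel transform as an integral with bounded integrand over a fixed interval. -/
lemma abel_eq_setIntegral (k : ℕ) (f : ℝ → ℝ) {z : ℝ} (hz : z ∈ Icc (0 : ℝ) 1) :
    abel k f z = 2 * (√(1 - z ^ 2) * ∫ t in Ioo (0 : ℝ) 1,
      (Polynomial.Chebyshev.T ℝ k).eval (z / abelSubst z t) * f (abelSubst z t)) := by
  rcases hz.2.eq_or_lt with rfl | hz1
  · simp [abel]
  have h1 : 0 < 1 - z ^ 2 := by nlinarith [hz.1, hz.2]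
  rw [abel, intervalIntegral.integral_of_le hz.2, integral_Ioc_eq_integral_Ioo,
    ← image_abelSubst ⟨hz.1, hz1⟩,
    integral_image_eq_integral_abs_deriv_smul measurableSet_Ioo
      (fun t ht => (hasDerivAt_abelSubst z ht).hasDerivWithinAt) (injOn_abelSubst ⟨hz.1, hz1⟩),
    ← integral_const_mul (√(1 - z ^ 2))]
  refine congrArg ((2 : ℝ) * ·) (setIntegral_congr_fun measurableSet_Ioo fun t ht => ?_)
  have h2 := abelSubst_pos z ht
  have h3 : 0 < √(1 - z ^ 2) := Real.sqrt_pos.2 h1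
  have h4 := Real.sq_sqrt h1.le
  have ht0 := ht.1
  simp only [smul_eq_mul]
  rw [sqrt_one_sub_div_abelSubst hz ht, abs_of_nonneg (by positivity)]
  field_simp
  rw [h4]
  ring

lemma continuousOn_abelSubst_integrand (k : ℕ) {f : ℝ → ℝ} (hf : ContinuousOn f (Icc 0 1)) :
    ContinuousOn (fun p : ℝ × ℝ =>
      (Polynomial.Chebyshev.T ℝ k).eval (p.1 / abelSubst p.1 p.2) * f (abelSubst p.1 p.2))
      (Icc 0 1 ×ˢ Ioo 0 1) := by
  have h := continuous_abelSubst.continuousOn (s := Icc 0 1 ×ˢ Ioo 0 1)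
  refine ContinuousOn.mul ?_ (hf.comp h fun p hp => ⟨(abelSubst_pos p.1 hp.2).le,
    abelSubst_le_one hp.1 hp.2⟩)
  exact (Polynomial.continuous _).comp_continuousOn
    (continuousOn_fst.div h fun p hp => (abelSubst_pos p.1 hp.2).ne')

/-- For `f` continuous on `[0,1]` (with `f(0) = 0` if `k ≥ 1`), the
generalized Abel transform `A_k f` is continuous on `[0,1]`. -/
theorem stmt8 (k : ℕ) (f : ℝ → ℝ)
    (hf : ContinuousOn f (Set.Icc 0 1)) (hf0 : 1 ≤ k → f 0 = 0) :
    ContinuousOn (abel k f) (Set.Icc 0 1) := by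
  obtain ⟨C, hC⟩ := isCompact_Icc.exists_bound_of_continuousOn hf
  obtain ⟨D, hD⟩ := isCompact_Icc.exists_bound_of_continuousOn
    ((Polynomial.Chebyshev.T ℝ k).continuous.continuousOn (s := Icc 0 1))
  have hF := continuousOn_abelSubst_integrand k hf
  refine ContinuousOn.congr ?_ fun z hz => abel_eq_setIntegral k f hz
  refine continuousOn_const.mul (ContinuousOn.mul (by fun_prop) ?_)
  refine continuousOn_of_dominated (bound := fun _ => D * C) (fun z hz => ?_) (fun z hz => ?_)
    (integrable_const _) ?_
  · exact (hF.comp (f := fun t : ℝ => (z, t)) (by fun_prop)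
      fun t ht => ⟨hz, ht⟩).aestronglyMeasurable measurableSet_Ioo
  · refine (ae_restrict_iff' measurableSet_Ioo).2 (.of_forall fun t ht => ?_)
    have h2 := abelSubst_pos z ht
    have hD' := hD (z / abelSubst z t) ⟨div_nonneg hz.1 h2.le, (div_le_one h2).2 (le_abelSubst hz)⟩
    rw [norm_mul]
    exact mul_le_mul hD' (hC _ ⟨h2.le, abelSubst_le_one hz ht⟩) (norm_nonneg _)
      ((norm_nonneg _).trans hD')
  · refine (ae_restrict_iff' measurableSet_Ioo).2 (.of_forall fun t ht => ?_)
    exact hF.comp (f := fun z : ℝ => (z, t)) (by fun_prop) fun z hz => ⟨hz, ht⟩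
end

section
/- Let k ≥ 0 be an integer and let f : [0,1] → ℝ be continuous, with f(0) = 0 if k ≥ 1. Then for every z ∈ [0,1], |A_k f(z)| ≤ 2 √(1 − z²) · sup_{y∈[0,1]} |f(y)|; in particular sup_{z∈[0,1]} |A_k f(z)| ≤ 2 sup_{y∈[0,1]} |f(y)|, so the generalized Abel transform A_k has operator norm at most 2 with respect to the supremum norm. -/
open Real MeasureTheory Set

theorem hasDerivAt_sqrt_sq_sub_sq {z y : ℝ} (hz : 0 ≤ z) (hzy : z < y) :
    HasDerivAt (fun y => Real.sqrt (y ^ 2 - z ^ 2)) (1 / Real.sqrt (1 - (z / y) ^ 2)) y := by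
  have hy : 0 < y := hz.trans_lt hzy
  have hpos : 0 < y ^ 2 - z ^ 2 := by nlinarith
  have hsq : Real.sqrt (1 - (z / y) ^ 2) = Real.sqrt (y ^ 2 - z ^ 2) / y := by
    rw [← Real.sqrt_sq hy.le, ← Real.sqrt_div' _ (sq_nonneg y), Real.sqrt_sq hy.le]
    congr 1
    field_simp
  have h := ((hasDerivAt_pow 2 y).sub_const (z ^ 2)).sqrt hpos.ne'
  convert h using 1
  rw [hsq]
  have := Real.sqrt_pos.2 hpos
  field_simp
  push_cast
  ring

theorem intervalIntegrable_one_div_sqrt_one_sub_div_sq {z : ℝ} (hz : z ∈ Icc (0 : ℝ) 1) :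
    IntervalIntegrable (fun y => 1 / Real.sqrt (1 - (z / y) ^ 2)) volume z 1 := by
  refine intervalIntegral.intervalIntegrable_deriv_of_nonneg
    (g := fun y => Real.sqrt (y ^ 2 - z ^ 2)) (by fun_prop) ?_ fun _ _ => by positivity
  rw [min_eq_left hz.2]
  exact fun y hy => hasDerivAt_sqrt_sq_sub_sq hz.1 hy.1

theorem integral_one_div_sqrt_one_sub_div_sq {z : ℝ} (hz : z ∈ Icc (0 : ℝ) 1) :
    ∫ y in z..1, 1 / Real.sqrt (1 - (z / y) ^ 2) = Real.sqrt (1 - z ^ 2) := by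
  rw [intervalIntegral.integral_eq_sub_of_hasDerivAt_of_le
    (f := fun y => Real.sqrt (y ^ 2 - z ^ 2)) hz.2 (by fun_prop)
    (fun y hy => hasDerivAt_sqrt_sq_sub_sq hz.1 hy.1)
    (intervalIntegrable_one_div_sqrt_one_sub_div_sq hz)]
  simp

theorem abs_abel_le (k : ℕ) {f : ℝ → ℝ} {M z : ℝ} (hM : ∀ y ∈ Icc (0 : ℝ) 1, |f y| ≤ M)
    (hz : z ∈ Icc (0 : ℝ) 1) : |abel k f z| ≤ 2 * Real.sqrt (1 - z ^ 2) * M := by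
  have key := intervalIntegral.norm_integral_le_of_norm_le (μ := volume)
    (f := fun y => (Polynomial.Chebyshev.T ℝ k).eval (z / y) * f y / Real.sqrt (1 - (z / y) ^ 2))
    (g := fun y => M * (1 / Real.sqrt (1 - (z / y) ^ 2))) hz.2
    (Filter.Eventually.of_forall fun y hy => by
      have hy0 : 0 < y := hz.1.trans_lt hy.1
      have hT : |(Polynomial.Chebyshev.T ℝ k).eval (z / y)| ≤ 1 := by
        refine Polynomial.Chebyshev.abs_eval_T_real_le_one k ?_
        rw [abs_of_nonneg (div_nonneg hz.1 hy0.le)]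
        exact (div_le_one hy0).2 hy.1.le
      rw [Real.norm_eq_abs, abs_div, abs_mul, abs_of_nonneg (Real.sqrt_nonneg _), mul_one_div]
      gcongr
      exact (mul_le_of_le_one_left (abs_nonneg _) hT).trans (hM y ⟨hy0.le, hy.2⟩))
    ((intervalIntegrable_one_div_sqrt_one_sub_div_sq hz).const_mul M)
  rw [intervalIntegral.integral_const_mul, integral_one_div_sqrt_one_sub_div_sq hz,
    Real.norm_eq_abs] at key
  rw [abel, abs_mul, abs_two]
  linarith

/-- For `f` continuous on `[0,1]` (with `f(0) = 0` if `k ≥ 1`),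
`|A_k f(z)| ≤ 2√(1 − z²) · sup |f|`; in particular the supremum norm of `A_k f` on `[0,1]`
is at most twice that of `f`, so `A_k` has operator norm at most `2`. -/
theorem stmt9 (k : ℕ) (f : ℝ → ℝ)
    (hf : ContinuousOn f (Set.Icc 0 1)) (hf0 : 1 ≤ k → f 0 = 0) :
    (∀ z ∈ Set.Icc (0:ℝ) 1,
      |abel k f z| ≤ 2 * Real.sqrt (1 - z ^ 2) * ⨆ y : Set.Icc (0:ℝ) 1, |f y|) ∧
    (⨆ z : Set.Icc (0:ℝ) 1, |abel k f z|) ≤ 2 * ⨆ y : Set.Icc (0:ℝ) 1, |f y| := by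
  have hbdd : BddAbove (range fun y : Icc (0 : ℝ) 1 => |f y|) := by
    have h := (isCompact_Icc.image_of_continuousOn hf.abs).bddAbove
    rwa [image_eq_range] at h
  have hM : ∀ y ∈ Icc (0 : ℝ) 1, |f y| ≤ ⨆ y : Icc (0 : ℝ) 1, |f y| :=
    fun y hy => le_ciSup hbdd ⟨y, hy⟩
  refine ⟨fun z hz => abs_abel_le k hM hz, ?_⟩
  have : Nonempty (Icc (0 : ℝ) 1) := ⟨⟨0, by simp⟩⟩
  refine ciSup_le fun z => (abs_abel_le k hM z.2).trans ?_
  have hs : Real.sqrt (1 - (z : ℝ) ^ 2) ≤ 1 :=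
    Real.sqrt_le_one.2 (sub_le_self _ (sq_nonneg _))
  have hM0 := (abs_nonneg _).trans (hM 0 (by simp))
  nlinarith
end

section
/- Let k ≥ 0 be an integer and let f : [0,1] → ℝ be continuous, with f(0) = 0 if k ≥ 1. If A_k f(z) = 0 for every z ∈ [0,1], then f is identically zero; that is, the generalized Abel transform A_k is injective on this class of continuous functions. -/
open Real MeasureTheory Set

/-- A continuous function on `[0,1]` all of whose moments vanish is zero there. -/
theorem eqOn_zero_of_moments_eq_zero {g : ℝ → ℝ} (hg : Continuous g)
    (h : ∀ m : ℕ, ∫ y in (0:ℝ)..1, y ^ m * g y = 0) : ∀ y ∈ Icc (0:ℝ) 1, g y = 0 := by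
  have hp (p : Polynomial ℝ) : ∫ y in (0:ℝ)..1, p.eval y * g y = 0 := by
    induction p using Polynomial.induction_on' with
    | add p q hp hq =>
      simp only [Polynomial.eval_add, add_mul]
      rw [intervalIntegral.integral_add, hp, hq, add_zero] <;>
        exact Continuous.intervalIntegrable (by fun_prop) _ _
    | monomial n a =>
      simp only [Polynomial.eval_monomial, mul_assoc]
      rw [intervalIntegral.integral_const_mul, h, mul_zero]
  obtain ⟨C, hC⟩ := isCompact_Icc.exists_bound_of_continuousOn (hg.continuousOn (s := Icc (0:ℝ) 1))
  have hC0 : 0 ≤ C := (norm_nonneg _).trans (hC 0 (by simp))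
  have hsq : ∫ y in (0:ℝ)..1, g y * g y ≤ 0 := by
    refine le_of_forall_pos_le_add fun ε hε => ?_
    obtain ⟨p, hpg⟩ := exists_polynomial_near_of_continuousOn 0 1 g hg.continuousOn
      (ε / (C + 1)) (by positivity)
    have hsub : ∫ y in (0:ℝ)..1, g y * g y = ∫ y in (0:ℝ)..1, (g y - p.eval y) * g y := by
      simp only [sub_mul]
      rw [intervalIntegral.integral_sub, hp, sub_zero] <;>
        exact Continuous.intervalIntegrable (by fun_prop) _ _
    have hle : ‖∫ y in (0:ℝ)..1, (g y - p.eval y) * g y‖ ≤ ε / (C + 1) * C * |1 - 0| := by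
      refine intervalIntegral.norm_integral_le_of_norm_le_const fun y hy => ?_
      rw [uIoc_of_le zero_le_one] at hy
      have hy' := Ioc_subset_Icc_self hy
      rw [norm_mul, Real.norm_eq_abs, abs_sub_comm]
      exact mul_le_mul (hpg y hy').le (hC y hy') (norm_nonneg _) (by positivity)
    have hε' : ε / (C + 1) * C * |(1:ℝ) - 0| ≤ ε := by
      rw [sub_zero, abs_one, mul_one, div_mul_eq_mul_div, div_le_iff₀ (by positivity)]
      nlinarith
    rw [hsub, zero_add]
    exact (le_abs_self _).trans (hle.trans hε')
  intro y hy
  by_contra hne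
  exact hsq.not_gt <| intervalIntegral.integral_pos zero_lt_one (hg.mul hg).continuousOn
    (fun x _ => mul_self_nonneg _) ⟨y, hy, mul_self_pos.2 hne⟩

theorem integral_Ioi_pow_mul_comp_div (φ : ℝ → ℝ) (n : ℕ) {y : ℝ} (hy : 0 < y) :
    ∫ z in Ioi (0:ℝ), z ^ n * φ (z / y) = y ^ (n + 1) * ∫ u in Ioi (0:ℝ), u ^ n * φ u := by
  have := integral_comp_mul_right_Ioi (fun u => u ^ n * φ u) 0 (inv_pos.2 hy)
  simp only [zero_mul, inv_inv, smul_eq_mul] at this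
  rw [pow_succ, mul_assoc, ← this, ← integral_const_mul]
  refine integral_congr_ae (.of_forall fun z => ?_)
  simp only [div_eq_mul_inv, mul_pow, inv_pow]
  field_simp

theorem integrableOn_Ioi_pow_mul_comp_div {φ : ℝ → ℝ} {n : ℕ}
    (hφ : IntegrableOn (fun u => u ^ n * φ u) (Ioi 0)) {y : ℝ} (hy : 0 < y) :
    IntegrableOn (fun z => z ^ n * φ (z / y)) (Ioi 0) := by
  have := (integrableOn_Ioi_comp_mul_right_iff (fun u => u ^ n * φ u) 0 (inv_pos.2 hy)).2
    (by simpa using hφ)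
  refine (this.const_mul (y ^ n)).congr (.of_forall fun z => ?_)
  simp only [div_eq_mul_inv, mul_pow, inv_pow]
  field_simp

/-- The moments of a multiplicative convolution are products of moments. -/
theorem integral_pow_mul_integral_comp_div {φ f : ℝ → ℝ} {n : ℕ} (hφm : Measurable φ)
    (hφ : IntegrableOn (fun u => u ^ n * φ u) (Ioi 0)) (hf : Continuous f) :
    ∫ z in Ioi (0:ℝ), z ^ n * ∫ y in Ioc (0:ℝ) 1, φ (z / y) * f y =
      (∫ u in Ioi (0:ℝ), u ^ n * φ u) * ∫ y in Ioc (0:ℝ) 1, y ^ (n + 1) * f y := by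
  have hint : Integrable (Function.uncurry fun z y => z ^ n * φ (z / y) * f y)
      ((volume.restrict (Ioi (0:ℝ))).prod (volume.restrict (Ioc (0:ℝ) 1))) := by
    have hm : Measurable (Function.uncurry fun z y => z ^ n * φ (z / y) * f y) := by
      have := hf.measurable
      simp only [Function.uncurry_def]
      fun_prop
    refine (integrable_prod_iff' hm.aestronglyMeasurable).2 ⟨?_, ?_⟩
    · filter_upwards [ae_restrict_mem measurableSet_Ioc] with y hy
      exact (integrableOn_Ioi_pow_mul_comp_div hφ hy.1).mul_const (f y)
    · have hc : Continuous fun y =>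
          y ^ (n + 1) * (∫ u in Ioi (0:ℝ), u ^ n * |φ u|) * |f y| := by fun_prop
      refine (hc.integrableOn_Ioc (a := 0) (b := 1)).congr ?_
      filter_upwards [ae_restrict_mem measurableSet_Ioc] with y hy
      rw [← integral_Ioi_pow_mul_comp_div (fun u => |φ u|) n hy.1, ← integral_mul_const]
      refine setIntegral_congr_fun measurableSet_Ioi fun z hz => ?_
      simp [Function.uncurry, abs_of_pos (mem_Ioi.1 hz)]
  calc _ = ∫ z in Ioi (0:ℝ), ∫ y in Ioc (0:ℝ) 1, z ^ n * φ (z / y) * f y := by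
        simp only [← integral_const_mul, mul_assoc]
    _ = ∫ y in Ioc (0:ℝ) 1, ∫ z in Ioi (0:ℝ), z ^ n * φ (z / y) * f y :=
        integral_integral_swap hint
    _ = _ := by
        rw [← integral_const_mul]
        refine setIntegral_congr_fun measurableSet_Ioc fun y hy => ?_
        rw [integral_mul_const, integral_Ioi_pow_mul_comp_div φ n hy.1]
        ring

theorem integral_cos_pow_mul_cos_succ (n k : ℕ) :
    (n + k + 2 : ℝ) * ∫ θ in (0:ℝ)..π / 2, cos θ ^ (n + 1) * cos ((k + 1 : ℕ) * θ) =
      (n + 1) * ∫ θ in (0:ℝ)..π / 2, cos θ ^ n * cos (k * θ) := by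
  have hd (θ : ℝ) : HasDerivAt (fun θ => cos θ ^ (n + 1) * sin ((k + 1 : ℕ) * θ))
      ((n + k + 2) * (cos θ ^ (n + 1) * cos ((k + 1 : ℕ) * θ)) -
        (n + 1) * (cos θ ^ n * cos (k * θ))) θ := by
    have h1 := (hasDerivAt_cos θ).pow (n + 1)
    have h2 := ((hasDerivAt_id θ).const_mul ((k + 1 : ℕ) : ℝ)).sin
    refine (h1.mul h2).congr_deriv ?_
    have hk : cos (k * θ) = cos ((k + 1 : ℕ) * θ) * cos θ + sin ((k + 1 : ℕ) * θ) * sin θ := by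
      rw [← cos_sub]; push_cast; ring_nf
    rw [hk]
    simp only [id, Nat.add_sub_cancel, Pi.pow_apply]
    push_cast
    ring
  have hF := intervalIntegral.integral_eq_sub_of_hasDerivAt (a := 0) (b := π / 2)
    (fun θ _ => hd θ) (Continuous.intervalIntegrable (by fun_prop) _ _)
  rw [intervalIntegral.integral_sub, intervalIntegral.integral_const_mul,
    intervalIntegral.integral_const_mul] at hF
  · simp only [cos_pi_div_two, mul_zero, sin_zero, ne_eq, Nat.succ_ne_zero, not_false_eq_true,
      zero_pow, zero_mul, sub_self] at hF
    linarith
  all_goals exact Continuous.intervalIntegrable (by fun_prop) _ _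

theorem integral_cos_pow_mul_cos_pos (m k : ℕ) :
    0 < ∫ θ in (0:ℝ)..π / 2, cos θ ^ (m + k) * cos (k * θ) := by
  induction k with
  | zero =>
    refine intervalIntegral.integral_pos (by positivity) (by fun_prop) (fun θ hθ => ?_)
      ⟨0, left_mem_Icc.2 (by positivity), by simp⟩
    have := cos_nonneg_of_mem_Icc (x := θ) ⟨by linarith [hθ.1, pi_pos], hθ.2⟩
    simpa using pow_nonneg this m
  | succ k ih =>
    have h := integral_cos_pow_mul_cos_succ (m + k) k
    refine pos_of_mul_pos_right (a := ((m + k : ℕ) + k + 2 : ℝ)) ?_ (by positivity)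
    rw [← add_assoc, h]
    positivity

theorem integral_mul_inv_sqrt_one_sub_sq (g : ℝ → ℝ) :
    ∫ x in (0:ℝ)..1, g x * (√(1 - x ^ 2))⁻¹ = ∫ θ in (0:ℝ)..π / 2, g (cos θ) := by
  have h := intervalIntegral.integral_comp_mul_deriv_of_deriv_nonpos
    (f := arccos) (f' := fun x => -(1 / √(1 - x ^ 2))) (g := fun θ => g (cos θ)) (a := 1) (b := 0)
    (by fun_prop) (fun x hx ↦ by
      simp only [zero_le_one, inf_of_le_right, sup_of_le_left, mem_Ioo] at hx
      exact (hasDerivAt_arccos (by linarith) (by linarith)))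
    (fun x _ => by simp)
  rw [arccos_one, arccos_zero] at h
  rw [← h, intervalIntegral.integral_symm, ← intervalIntegral.integral_neg]
  refine intervalIntegral.integral_congr fun x hx => ?_
  rw [uIcc_of_ge zero_le_one] at hx
  simp [cos_arccos (x := x) (by linarith [hx.1]) hx.2]

/-- The kernel of the generalized Abel transform, as a function of `z / y`. It vanishes for
arguments at least `1`, because there the square root does. -/
noncomputable def abelKernel (k : ℕ) (u : ℝ) : ℝ :=
  (Polynomial.Chebyshev.T ℝ k).eval u * (√(1 - u ^ 2))⁻¹

theorem measurable_abelKernel (k : ℕ) : Measurable (abelKernel k) := by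
  unfold abelKernel
  fun_prop

theorem abelKernel_of_one_le (k : ℕ) {u : ℝ} (hu : 1 ≤ u) : abelKernel k u = 0 := by
  rw [abelKernel, Real.sqrt_eq_zero_of_nonpos (by nlinarith), inv_zero, mul_zero]

theorem integrableOn_pow_mul_abelKernel (k n : ℕ) :
    IntegrableOn (fun u => u ^ n * abelKernel k u) (Ioi 0) := by
  have h : IntegrableOn (fun u => u ^ n * abelKernel k u) (Ioc 0 1) := by
    have h1 : IntervalIntegrable (fun x : ℝ => (√(1 - x ^ 2))⁻¹) volume 0 1 := by
      have := Polynomial.Chebyshev.intervalIntegrable_sqrt_one_sub_sq_inv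
      simp only [Real.sqrt_inv] at this
      exact this.mono_set (uIcc_subset_uIcc (by simp) (by simp))
    have h2 := h1.continuousOn_mul
      (g := fun u => u ^ n * (Polynomial.Chebyshev.T ℝ k).eval u) (by fun_prop)
    rw [intervalIntegrable_iff_integrableOn_Ioc_of_le zero_le_one] at h2
    simpa only [abelKernel, mul_assoc] using h2
  refine h.of_forall_sdiff_eq_zero measurableSet_Ioi fun u hu => ?_
  have : 1 ≤ u := by
    by_contra! hlt
    exact hu.2 ⟨hu.1, hlt.le⟩
  rw [abelKernel_of_one_le k this, mul_zero]

theorem integral_pow_mul_abelKernel_pos (k m : ℕ) :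
    0 < ∫ u in Ioi (0:ℝ), u ^ (m + k) * abelKernel k u := by
  have h : ∫ u in Ioi (0:ℝ), u ^ (m + k) * abelKernel k u =
      ∫ u in Ioc (0:ℝ) 1, u ^ (m + k) * abelKernel k u := by
    refine setIntegral_eq_of_subset_of_forall_sdiff_eq_zero measurableSet_Ioi
      Ioc_subset_Ioi_self fun u hu => ?_
    have : 1 ≤ u := by
      by_contra! hlt
      exact hu.2 ⟨hu.1, hlt.le⟩
    rw [abelKernel_of_one_le k this, mul_zero]
  rw [h, ← intervalIntegral.integral_of_le zero_le_one]
  simp only [abelKernel, ← mul_assoc]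
  rw [integral_mul_inv_sqrt_one_sub_sq
    (fun u => u ^ (m + k) * (Polynomial.Chebyshev.T ℝ k).eval u)]
  simpa using integral_cos_pow_mul_cos_pos m k

theorem abel_eq_integral_abelKernel (k : ℕ) (f : ℝ → ℝ) {z : ℝ} (hz : z ∈ Icc (0:ℝ) 1) :
    abel k f z = 2 * ∫ y in Ioc (0:ℝ) 1, abelKernel k (z / y) * f y := by
  rw [abel, intervalIntegral.integral_of_le hz.2]
  congr 1
  have h : ∫ y in Ioc (0:ℝ) 1, abelKernel k (z / y) * f y =
      ∫ y in Ioc z 1, abelKernel k (z / y) * f y := by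
    refine setIntegral_eq_of_subset_of_forall_sdiff_eq_zero measurableSet_Ioc
      (Ioc_subset_Ioc_left hz.1) fun y hy => ?_
    have : y ≤ z := by
      by_contra! hlt
      exact hy.2 ⟨hlt, hy.1.2⟩
    rw [abelKernel_of_one_le k ((one_le_div hy.1.1).2 this), zero_mul]
  rw [h]
  refine integral_congr_ae (.of_forall fun y => ?_)
  simp only [abelKernel, div_eq_mul_inv]
  ring

/-- The generalized Abel transform `A_k` is injective on continuous
functions on `[0,1]` (vanishing at `0` when `k ≥ 1`). -/
theorem stmt10 (k : ℕ) (f : ℝ → ℝ)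
    (hf : ContinuousOn f (Set.Icc 0 1)) (hf0 : 1 ≤ k → f 0 = 0)
    (h : ∀ z ∈ Set.Icc (0:ℝ) 1, abel k f z = 0) :
    ∀ y ∈ Set.Icc (0:ℝ) 1, f y = 0 := by
  set F : ℝ → ℝ := IccExtend zero_le_one ((Icc (0:ℝ) 1).domRestrict f)
  have hFc : Continuous F := Continuous.Icc_extend' (continuousOn_iff_continuous_domRestrict.1 hf)
  have hFf : ∀ y ∈ Icc (0:ℝ) 1, F y = f y := fun y hy => IccExtend_of_mem _ _ hy
  have hker (z : ℝ) (hz : 0 < z) : ∫ y in Ioc (0:ℝ) 1, abelKernel k (z / y) * F y = 0 := by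
    rcases le_or_gt z 1 with hz1 | hz1
    · have hA := h z ⟨hz.le, hz1⟩
      rw [abel_eq_integral_abelKernel k f ⟨hz.le, hz1⟩] at hA
      refine Eq.trans ?_ ((mul_eq_zero.1 hA).resolve_left two_ne_zero)
      refine setIntegral_congr_fun measurableSet_Ioc fun y hy => ?_
      simp only [hFf y (Ioc_subset_Icc_self hy)]
    · refine setIntegral_eq_zero_of_forall_eq_zero fun y hy => ?_
      rw [abelKernel_of_one_le k ((one_le_div hy.1).2 (hy.2.trans hz1.le)), zero_mul]
  have hmom (m : ℕ) : ∫ y in (0:ℝ)..1, y ^ m * (y ^ (k + 1) * F y) = 0 := by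
    have hconv := integral_pow_mul_integral_comp_div (measurable_abelKernel k)
      (integrableOn_pow_mul_abelKernel k (m + k)) hFc
    rw [setIntegral_eq_zero_of_forall_eq_zero fun z hz => by rw [hker z hz, mul_zero]] at hconv
    rw [intervalIntegral.integral_of_le zero_le_one]
    simpa only [← mul_assoc, ← pow_add, ← add_assoc] using
      (mul_eq_zero.1 hconv.symm).resolve_left (integral_pow_mul_abelKernel_pos k m).ne'
  have hzero := eqOn_zero_of_moments_eq_zero (g := fun y => y ^ (k + 1) * F y) (by fun_prop) hmom
  have hpos : EqOn f 0 (Ioc 0 1) := fun y hy => by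
    have hy' := Ioc_subset_Icc_self hy
    rw [← hFf y hy']
    exact (mul_eq_zero.1 (hzero y hy')).resolve_left (pow_ne_zero _ hy.1.ne')
  refine hpos.of_subset_closure hf continuousOn_const Ioc_subset_Icc_self ?_
  rw [closure_Ioc zero_ne_one]
end
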